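/- Suppose z* is a solution at which MFCQ, the second-order condition and strict complementarity are satisfied, fix centrality constants C > 0, γ ∈ (0,1), and suppose ‖t‖ ≤ K_t μ². Then there exist K > 0, μ̄ > 0 and a neighborhood W of S such that for every iterate (z,λ,s) satisfying the approximate centrality conditions with (z,λ) ∈ W and μ ≤ μ̄, the exact step (Δz,Δλ,Δs) satisfies: (i) there exists α_max ∈ [0,1] with 1 − α_max ≤ Kμ such that λ + αΔλ > 0 and s + αΔs > 0 for all α ∈ [0, α_max); and (ii) for all α ∈ [0,1] and all i, |(λ_i + αΔλ_i)(s_i + αΔs_i) − (1−α)λ_i s_i| ≤ Kμ², |μ(λ+αΔλ, s+αΔs) − (1−α)μ| ≤ Kμ², ‖L_z(z+αΔz, λ+αΔλ) − (1−α)L_z(z,λ)‖ ≤ Kμ², and ‖g(z+αΔz) + s + αΔs − (1−α)(g(z)+s)‖ ≤ Kμ², where μ(λ,s) = λᵀs/m. -/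

import Mathlib

open Matrix
open scoped BigOperators

noncomputable section

attribute [local instance] Classical.propDecidable

/-- Euclidean norm of a finitely indexed family of real numbers. -/
def evnorm {ι : Type*} [Fintype ι] (v : ι → ℝ) : ℝ :=
  Real.sqrt (∑ i, v i ^ 2)

/-- Frobenius norm of a real matrix. -/
def mnorm {ι κ : Type*} [Fintype ι] [Fintype κ] (M : Matrix ι κ ℝ) : ℝ :=
  Real.sqrt (∑ i, ∑ j, M i j ^ 2)

/-- Smallest singular value of a real matrix. -/
def sigmaMin {ι κ : Type*} [Fintype ι] [Fintype κ] (M : Matrix ι κ ℝ) : ℝ :=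
  sInf {t | ∃ x : κ → ℝ, evnorm x = 1 ∧ t = evnorm (M.mulVec x)}

/-- The continuous linear functional `x ↦ ⟨v, x⟩` on `ℝⁿ`. -/
def dotCLM {n : ℕ} (v : Fin n → ℝ) : (Fin n → ℝ) →L[ℝ] ℝ :=
  ∑ i, v i • (ContinuousLinearMap.proj (R := ℝ) (φ := fun _ : Fin n => ℝ) i)

/-- The continuous linear map `x ↦ M x` on `ℝⁿ`. -/
def matCLM {n : ℕ} (M : Matrix (Fin n) (Fin n) ℝ) : (Fin n → ℝ) →L[ℝ] (Fin n → ℝ) :=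
  LinearMap.toContinuousLinearMap (Matrix.toLin' M)

/-- Duality measure `μ(λ,s) = λᵀ s / m`. -/
def dmu {m : ℕ} (lam s : Fin m → ℝ) : ℝ := (∑ i, lam i * s i) / (m : ℝ)

/-- Data of the nonlinear program `min φ(z)  s.t.  g(z) ≤ 0`, with `φ` and each `gᵢ`
twice Lipschitz continuously differentiable; `gradphi`, `gradg` are the gradients and
`hessphi`, `hessg` the (symmetric) Hessians. -/
structure NLP (n m : ℕ) where
  phi : (Fin n → ℝ) → ℝ
  g : Fin m → (Fin n → ℝ) → ℝ
  gradphi : (Fin n → ℝ) → Fin n → ℝ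
  gradg : Fin m → (Fin n → ℝ) → Fin n → ℝ
  hessphi : (Fin n → ℝ) → Matrix (Fin n) (Fin n) ℝ
  hessg : Fin m → (Fin n → ℝ) → Matrix (Fin n) (Fin n) ℝ
  grad_phi : ∀ z, HasFDerivAt phi (dotCLM (gradphi z)) z
  grad_g : ∀ i z, HasFDerivAt (g i) (dotCLM (gradg i z)) z
  hess_phi : ∀ z, HasFDerivAt gradphi (matCLM (hessphi z)) z
  hess_g : ∀ i z, HasFDerivAt (gradg i) (matCLM (hessg i z)) z
  hessphi_symm : ∀ z, (hessphi z).IsSymm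
  hessg_symm : ∀ i z, (hessg i z).IsSymm
  lip_phi : ∃ K, ∀ z z', mnorm (hessphi z - hessphi z') ≤ K * evnorm (z - z')
  lip_g : ∀ i, ∃ K, ∀ z z', mnorm (hessg i z - hessg i z') ≤ K * evnorm (z - z')

namespace NLP

variable {n m : ℕ} (P : NLP n m)

/-- Gradient of the Lagrangian with respect to `z`:  `L_z(z,λ) = ∇φ(z) + ∇g(z)λ`. -/
def Lz (z : Fin n → ℝ) (lam : Fin m → ℝ) : Fin n → ℝ :=
  fun j => P.gradphi z j + ∑ i, lam i * P.gradg i z j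

/-- Hessian of the Lagrangian with respect to `z`. -/
def Lzz (z : Fin n → ℝ) (lam : Fin m → ℝ) : Matrix (Fin n) (Fin n) ℝ :=
  P.hessphi z + ∑ i, lam i • P.hessg i z

/-- The KKT conditions at `(z, λ)`. -/
def KKT (z : Fin n → ℝ) (lam : Fin m → ℝ) : Prop :=
  P.Lz z lam = 0 ∧ (∀ i, P.g i z ≤ 0) ∧ (∀ i, 0 ≤ lam i) ∧ (∑ i, lam i * P.g i z) = 0

/-- The set `S_λ` of optimal Lagrange multipliers at `z*`. -/
def Slam (zstar : Fin n → ℝ) : Set (Fin m → ℝ) := {lam | P.KKT zstar lam}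

/-- The Mangasarian–Fromovitz constraint qualification at `z*`. -/
def MFCQ (zstar : Fin n → ℝ) : Prop :=
  ∃ ybar : Fin n → ℝ, ∀ i, P.g i zstar = 0 → (∑ j, P.gradg i zstar j * ybar j) < 0

/-- The index set `B₊` of active constraints with a positive multiplier. -/
def BPlus (zstar : Fin n → ℝ) : Set (Fin m) :=
  {i | P.g i zstar = 0 ∧ ∃ ls ∈ P.Slam zstar, 0 < ls i}

/-- The second-order sufficient condition at `z*`. -/
def SOC (zstar : Fin n → ℝ) : Prop :=
  ∃ ξ : ℝ, 0 < ξ ∧ ∀ ls ∈ P.Slam zstar, ∀ w : Fin n → ℝ,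
    (∀ i, i ∈ P.BPlus zstar → (∑ j, P.gradg i zstar j * w j) = 0) →
    (∀ i, P.g i zstar = 0 → i ∉ P.BPlus zstar → (∑ j, P.gradg i zstar j * w j) ≤ 0) →
    ξ * evnorm w ^ 2 ≤ w ⬝ᵥ (P.Lzz zstar ls).mulVec w

/-- The strict complementarity condition `B₊ = B` at `z*`. -/
def StrictComp (zstar : Fin n → ℝ) : Prop :=
  ∀ i, P.g i zstar = 0 → i ∈ P.BPlus zstar

/-- `z*` is a solution of the nonlinear program: it is feasible, it is a local
minimizer, and the first-order KKT conditions hold there. -/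
def isSolution (zstar : Fin n → ℝ) : Prop :=
  (∀ i, P.g i zstar ≤ 0) ∧ (∃ lam, P.KKT zstar lam) ∧
  ∀ᶠ z in nhds zstar, (∀ i, P.g i z ≤ 0) → P.phi zstar ≤ P.phi z

/-- Euclidean distance `δ(z,λ)` from `(z,λ)` to the primal–dual solution set
`S = {z*} × S_λ`. -/
def delta (zstar z : Fin n → ℝ) (lam : Fin m → ℝ) : ℝ :=
  sInf {d | ∃ ls ∈ P.Slam zstar,
    d = Real.sqrt (evnorm (z - zstar) ^ 2 + evnorm (lam - ls) ^ 2)}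

/-- The approximate centrality conditions with constants `C`, `γ`. -/
def central (C gam : ℝ) (z : Fin n → ℝ) (lam s : Fin m → ℝ) : Prop :=
  evnorm (P.Lz z lam) ≤ C * dmu lam s ∧
  evnorm (fun i => P.g i z + s i) ≤ C * dmu lam s ∧
  (∀ i, 0 < lam i) ∧ (∀ i, 0 < s i) ∧ (∀ i, gam * dmu lam s ≤ lam i * s i)

/-- The active index set `B` at `z*`, as a type. -/
abbrev Bsub (zstar : Fin n → ℝ) : Type := {i : Fin m // P.g i zstar = 0}

/-- The inactive index set `N` at `z*`, as a type. -/
abbrev Nsub (zstar : Fin n → ℝ) : Type := {i : Fin m // ¬ P.g i zstar = 0}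

/-- `∇g(z)`:  the `n × m` matrix whose columns are the constraint gradients. -/
def Gfull (z : Fin n → ℝ) : Matrix (Fin n) (Fin m) ℝ :=
  Matrix.of fun j i => P.gradg i z j

/-- `∇g_B(z)`:  the columns of `∇g(z)` indexed by the active set `B` at `z*`. -/
def GB (zstar z : Fin n → ℝ) : Matrix (Fin n) (P.Bsub zstar) ℝ :=
  Matrix.of fun j b => P.gradg b.1 z j

/-- `∇g_N(z)`:  the columns of `∇g(z)` indexed by the inactive set `N` at `z*`. -/
def GN (zstar z : Fin n → ℝ) : Matrix (Fin n) (P.Nsub zstar) ℝ :=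
  Matrix.of fun j b => P.gradg b.1 z j

/-- The diagonal matrix `D_B = Λ_B⁻¹ S_B`. -/
def DB (zstar : Fin n → ℝ) (lam s : Fin m → ℝ) :
    Matrix (P.Bsub zstar) (P.Bsub zstar) ℝ :=
  Matrix.diagonal fun b => s b.1 / lam b.1

/-- The diagonal matrix `D_N = Λ_N⁻¹ S_N`. -/
def DN (zstar : Fin n → ℝ) (lam s : Fin m → ℝ) :
    Matrix (P.Nsub zstar) (P.Nsub zstar) ℝ :=
  Matrix.diagonal fun b => s b.1 / lam b.1

/-- The exact primal–dual step: the solution of the linear system (pdip.orig). -/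
def exactStep (z : Fin n → ℝ) (lam s t : Fin m → ℝ) (dz : Fin n → ℝ)
    (dl ds : Fin m → ℝ) : Prop :=
  (∀ j, ((P.Lzz z lam).mulVec dz) j + ((P.Gfull z).mulVec dl) j = -(P.Lz z lam j)) ∧
  (∀ i, (((P.Gfull z)ᵀ).mulVec dz) i + ds i = -(P.g i z + s i)) ∧
  (∀ i, s i * dl i + lam i * ds i = -(s i * lam i + t i))

end NLP

/-- Part (a) of Assumption A: `z*` is a solution at which MFCQ, the second-order
condition, and strict complementarity hold, and the current iterate `(z,λ,s)`
satisfies the approximate centrality conditions with constants `C`, `γ`. -/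
def AssumptionAa {n m : ℕ} (P : NLP n m) (zstar : Fin n → ℝ) (C gam : ℝ)
    (z : Fin n → ℝ) (lam s : Fin m → ℝ) : Prop :=
  P.isSolution zstar ∧ P.MFCQ zstar ∧ P.SOC zstar ∧ P.StrictComp zstar ∧
  P.central C gam z lam s

/-- The data of a singular value decomposition `∇g_B(z*) = Û Σ Uᵀ`, where the square
matrices `[Û V̂]` (of order `n`) and `[U V]` (of order `|B|`) are orthogonal and `Σ` is
diagonal with positive diagonal entries. -/
structure SVDdata {n m : ℕ} (P : NLP n m) (zstar : Fin n → ℝ) where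
  k : ℕ
  kc : ℕ
  r : ℕ
  Uhat : Matrix (Fin n) (Fin k) ℝ
  Vhat : Matrix (Fin n) (Fin kc) ℝ
  U : Matrix (P.Bsub zstar) (Fin k) ℝ
  V : Matrix (P.Bsub zstar) (Fin r) ℝ
  sig : Fin k → ℝ
  sig_pos : ∀ j, 0 < sig j
  hUhat : Uhatᵀ * Uhat = 1
  hVhat : Vhatᵀ * Vhat = 1
  hUVhat : Uhatᵀ * Vhat = 0
  hhat_complete : Uhat * Uhatᵀ + Vhat * Vhatᵀ = 1
  hU : Uᵀ * U = 1
  hV : Vᵀ * V = 1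
  hUV : Uᵀ * V = 0
  h_complete : U * Uᵀ + V * Vᵀ = 1
  hsvd : P.GB zstar zstar = Uhat * Matrix.diagonal sig * Uᵀ

section ExactStep

open Filter Asymptotics Topology
open scoped NNReal

section Norms

variable {ι κ : Type*} [Fintype ι] [Fintype κ]

theorem abs_le_evnorm (v : ι → ℝ) (i : ι) : |v i| ≤ evnorm v := by
  refine Real.abs_le_sqrt ?_
  exact Finset.single_le_sum (f := fun i => v i ^ 2) (fun _ _ => sq_nonneg _) (Finset.mem_univ i)

theorem evnorm_nonneg (v : ι → ℝ) : 0 ≤ evnorm v := Real.sqrt_nonneg _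

theorem evnorm_sq (v : ι → ℝ) : evnorm v ^ 2 = v ⬝ᵥ v := by
  rw [evnorm, Real.sq_sqrt (Finset.sum_nonneg fun _ _ => sq_nonneg _)]
  exact Finset.sum_congr rfl fun _ _ => sq _

theorem norm_le_evnorm (v : ι → ℝ) : ‖v‖ ≤ evnorm v :=
  (pi_norm_le_iff_of_nonneg (evnorm_nonneg v)).2 fun i => abs_le_evnorm v i

theorem dotProduct_self_le (v : ι → ℝ) : v ⬝ᵥ v ≤ Fintype.card ι * ‖v‖ ^ 2 := by
  have h : ∀ i ∈ Finset.univ, v i * v i ≤ ‖v‖ ^ 2 := fun i _ => by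
    have := norm_le_pi_norm v i
    rw [Real.norm_eq_abs] at this
    nlinarith [abs_nonneg (v i), abs_mul_abs_self (v i)]
  simpa [dotProduct, Finset.card_univ] using Finset.sum_le_sum h

theorem norm_sq_le_dotProduct_self (v : ι → ℝ) : ‖v‖ ^ 2 ≤ v ⬝ᵥ v := by
  rw [← evnorm_sq]
  exact pow_le_pow_left₀ (norm_nonneg _) (norm_le_evnorm v) 2

theorem evnorm_le_card_mul_norm (v : ι → ℝ) : evnorm v ≤ Fintype.card ι * ‖v‖ := by
  refine abs_le_of_sq_le_sq' ?_ (by positivity) |>.2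
  rw [evnorm_sq, mul_pow]
  refine (dotProduct_self_le v).trans (mul_le_mul_of_nonneg_right ?_ (sq_nonneg _))
  exact_mod_cast Nat.le_self_pow two_ne_zero _

theorem abs_dotProduct_le (v w : ι → ℝ) : |v ⬝ᵥ w| ≤ Fintype.card ι * (‖v‖ * ‖w‖) := by
  have h : ∀ i ∈ Finset.univ, |v i * w i| ≤ ‖v‖ * ‖w‖ := fun i _ => by
    rw [abs_mul]
    exact mul_le_mul (norm_le_pi_norm v i) (norm_le_pi_norm w i) (abs_nonneg _) (norm_nonneg _)
  refine (Finset.abs_sum_le_sum_abs _ _).trans ?_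
  simpa [Finset.card_univ] using Finset.sum_le_sum h

theorem abs_le_mnorm (M : Matrix ι κ ℝ) (i : ι) (j : κ) : |M i j| ≤ mnorm M := by
  refine Real.abs_le_sqrt ?_
  refine (Finset.single_le_sum (f := fun j => M i j ^ 2) (fun _ _ => sq_nonneg _)
    (Finset.mem_univ j)).trans ?_
  exact Finset.single_le_sum (f := fun i => ∑ j, M i j ^ 2)
    (fun _ _ => Finset.sum_nonneg fun _ _ => sq_nonneg _) (Finset.mem_univ i)

theorem norm_matCLM_le {n : ℕ} (M : Matrix (Fin n) (Fin n) ℝ) : ‖matCLM M‖ ≤ n * mnorm M := by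
  have hM : 0 ≤ mnorm M := Real.sqrt_nonneg _
  refine ContinuousLinearMap.opNorm_le_bound _ (by positivity) fun v => ?_
  refine (pi_norm_le_iff_of_nonneg (by positivity)).2 fun i => ?_
  have h := abs_dotProduct_le (M i) v
  rw [Fintype.card_fin] at h
  refine h.trans ?_
  rw [mul_assoc]
  gcongr
  exact (pi_norm_le_iff_of_nonneg hM).2 fun j => abs_le_mnorm M i j

theorem matCLM_apply {n : ℕ} (M : Matrix (Fin n) (Fin n) ℝ) (v : Fin n → ℝ) :
    matCLM M v = M.mulVec v := rfl

theorem matCLM_sub {n : ℕ} (M N : Matrix (Fin n) (Fin n) ℝ) :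
    matCLM (M - N) = matCLM M - matCLM N := by
  ext v i
  simp [matCLM_apply, Matrix.sub_mulVec]

theorem dotCLM_apply {n : ℕ} (v w : Fin n → ℝ) : dotCLM v w = v ⬝ᵥ w := by
  simp [dotCLM, dotProduct]

theorem norm_dotCLM_sub_le {n : ℕ} (v w : Fin n → ℝ) :
    ‖dotCLM v - dotCLM w‖ ≤ n * ‖v - w‖ := by
  refine ContinuousLinearMap.opNorm_le_bound _ (by positivity) fun u => ?_
  have h := abs_dotProduct_le (v - w) u
  rw [Fintype.card_fin, sub_dotProduct, ← mul_assoc] at h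
  simpa [dotCLM_apply] using h

end Norms

section LinearAlgebra

/-- A linear map between finite-dimensional spaces admits preimages of size controlled by the
image. -/
theorem LinearMap.exists_bounded_preimage {E F : Type*} [NormedAddCommGroup E] [NormedSpace ℝ E]
    [NormedAddCommGroup F] [NormedSpace ℝ F] [FiniteDimensional ℝ F] (A : E →ₗ[ℝ] F) :
    ∃ C : ℝ, 0 ≤ C ∧ ∃ p : E → E, ∀ v, A (p v) = A v ∧ ‖p v‖ ≤ C * ‖A v‖ := by
  obtain ⟨R, hR⟩ := A.rangeRestrict.exists_rightInverse_of_surjective A.range_rangeRestrict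
  refine ⟨‖LinearMap.toContinuousLinearMap R‖, ContinuousLinearMap.opNorm_nonneg _,
    fun v => R (A.rangeRestrict v), fun v => ⟨?_, ?_⟩⟩
  · have := LinearMap.congr_fun hR (A.rangeRestrict v)
    simpa using congrArg Subtype.val this
  · exact (LinearMap.toContinuousLinearMap R).le_opNorm (A.rangeRestrict v)

/-- A quadratic form that is positive definite on the common kernel of finitely many functionals
becomes positive definite after adding a large multiple of the sum of their squares. -/
theorem exists_penalty {ι : Type*} {n : ℕ} (M : Matrix (Fin n) (Fin n) ℝ)
    (B : Finset ι) (a : ι → Fin n → ℝ) {ξ : ℝ} (hξ : 0 < ξ)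
    (h : ∀ w : Fin n → ℝ, (∀ i ∈ B, a i ⬝ᵥ w = 0) → ξ * (w ⬝ᵥ w) ≤ w ⬝ᵥ M.mulVec w) :
    ∃ C : ℝ, 0 ≤ C ∧ ∀ w : Fin n → ℝ,
      ξ / 2 * ‖w‖ ^ 2 ≤ w ⬝ᵥ M.mulVec w + C * ∑ i ∈ B, (a i ⬝ᵥ w) ^ 2 := by
  let A : (Fin n → ℝ) →ₗ[ℝ] (B → ℝ) := LinearMap.pi fun i => (dotCLM (a i)).toLinearMap
  have hA : ∀ w i, A w i = a i ⬝ᵥ w := fun w i => dotCLM_apply _ _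
  obtain ⟨C, hC, p, hp⟩ := A.exists_bounded_preimage
  have hA_sq : ∀ w, ‖A w‖ ^ 2 ≤ ∑ i ∈ B, (a i ⬝ᵥ w) ^ 2 := fun w => by
    refine (norm_sq_le_dotProduct_self _).trans_eq ?_
    rw [← Finset.sum_coe_sort B]
    exact Finset.sum_congr rfl fun i _ => by rw [hA, sq]
  have hbound : ∃ c : ℝ, 0 ≤ c ∧ ∀ v w : Fin n → ℝ,
      |v ⬝ᵥ M.mulVec w| ≤ c * (‖v‖ * ‖w‖) := by
    refine ⟨n * ‖matCLM M‖, by positivity, fun v w => (abs_dotProduct_le _ _).trans ?_⟩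
    rw [Fintype.card_fin, mul_assoc]
    have := mul_le_mul_of_nonneg_left ((matCLM M).le_opNorm w) (norm_nonneg v)
    rw [matCLM_apply] at this
    refine mul_le_mul_of_nonneg_left ?_ (Nat.cast_nonneg n)
    linarith
  obtain ⟨c, hc, hcb⟩ := hbound
  set D : ℝ := 2 * n * ξ + 2 * c with hD
  have hD0 : 0 ≤ D := by positivity
  refine ⟨(D ^ 2 / (2 * ξ) + c) * C ^ 2, by positivity, fun w => ?_⟩
  have hker : ∀ i ∈ B, a i ⬝ᵥ (w - p w) = 0 := fun i hi => by
    have := congrFun (hp w).1 ⟨i, hi⟩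
    rw [hA, hA] at this
    rw [dotProduct_sub, this, sub_self]
  have key := h _ hker
  simp only [mulVec_sub, sub_dotProduct, dotProduct_sub] at key
  have h1 := abs_le.1 (hcb w (p w))
  have h2 := abs_le.1 (hcb (p w) w)
  have h3 := abs_le.1 (hcb (p w) (p w))
  have h4 := abs_le.1 (abs_dotProduct_le w (p w))
  rw [Fintype.card_fin] at h4
  rw [dotProduct_comm (p w) w] at key
  have h5 := (sq_nonneg ‖p w‖).trans (norm_sq_le_dotProduct_self (p w))
  have h6 := norm_sq_le_dotProduct_self w
  have hpw : ‖p w‖ ^ 2 ≤ C ^ 2 * ∑ i ∈ B, (a i ⬝ᵥ w) ^ 2 := by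
    calc ‖p w‖ ^ 2 ≤ (C * ‖A w‖) ^ 2 := pow_le_pow_left₀ (norm_nonneg _) (hp w).2 2
      _ = C ^ 2 * ‖A w‖ ^ 2 := mul_pow _ _ _
      _ ≤ _ := by gcongr; exact hA_sq w
  have h7 : D * (‖w‖ * ‖p w‖) ≤ ξ / 2 * ‖w‖ ^ 2 + D ^ 2 / (2 * ξ) * ‖p w‖ ^ 2 := by
    have := sq_nonneg (ξ * ‖w‖ - D * ‖p w‖)
    rw [← sub_nonneg]
    have e : ξ / 2 * ‖w‖ ^ 2 + D ^ 2 / (2 * ξ) * ‖p w‖ ^ 2 - D * (‖w‖ * ‖p w‖) =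
        (ξ * ‖w‖ - D * ‖p w‖) ^ 2 / (2 * ξ) := by
      field_simp
      ring
    rw [e]
    positivity
  have h8 : (D ^ 2 / (2 * ξ) + c) * ‖p w‖ ^ 2 ≤
      (D ^ 2 / (2 * ξ) + c) * (C ^ 2 * ∑ i ∈ B, (a i ⬝ᵥ w) ^ 2) := by gcongr
  have h9 := mul_le_mul_of_nonneg_left h6 hξ.le
  have h10 := mul_nonneg hξ.le h5
  have h11 := mul_le_mul_of_nonneg_left h4.2 hξ.le
  rw [hD] at h7
  nlinarith

end LinearAlgebra

section Asymptotics

variable {α : Type*} {l : Filter α}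

theorem Asymptotics.IsBigO.dotProduct {ι : Type*} [Fintype ι] {f g : α → ι → ℝ} {F G : α → ℝ}
    (hf : f =O[l] F) (hg : g =O[l] G) : (fun x => f x ⬝ᵥ g x) =O[l] fun x => F x * G x := by
  refine IsBigO.trans (IsBigO.of_bound (Fintype.card ι) (Eventually.of_forall fun x => ?_))
    (hf.norm_left.mul hg.norm_left)
  rw [Real.norm_of_nonneg (by positivity : (0 : ℝ) ≤ ‖f x‖ * ‖g x‖)]
  exact abs_dotProduct_le _ _

theorem Asymptotics.IsBigO.mulVec {n : ℕ} {M : α → Matrix (Fin n) (Fin n) ℝ}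
    {w : α → Fin n → ℝ} {F G : α → ℝ} (hM : (fun x => matCLM (M x)) =O[l] F)
    (hw : w =O[l] G) : (fun x => (M x).mulVec (w x)) =O[l] fun x => F x * G x :=
  IsBigO.trans (IsBigO.of_bound 1 (Eventually.of_forall fun x => by
    rw [one_mul, norm_mul, _root_.norm_norm, _root_.norm_norm]
    exact (matCLM (M x)).le_opNorm (w x))) (hM.norm_left.mul hw.norm_left)

/-- A quadratic self-estimate `X² = O(u (u + X))` forces `X = O(u)`. -/
theorem isBigO_of_sq_isBigO {X u : α → ℝ} (hX : ∀ x, 0 ≤ X x) (hu : ∀ x, 0 ≤ u x)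
    (h : (fun x => X x ^ 2) =O[l] fun x => u x * (u x + X x)) : X =O[l] u := by
  obtain ⟨c, hc, hb⟩ := h.exists_nonneg
  refine IsBigO.of_bound (c + 1) (hb.bound.mono fun x hx => ?_)
  have h0 := hX x
  have h1 := hu x
  rw [Real.norm_of_nonneg h0, Real.norm_of_nonneg h1]
  rw [Real.norm_of_nonneg (sq_nonneg _), Real.norm_of_nonneg (by positivity)] at hx
  by_contra! hlt
  nlinarith [mul_nonneg hc h1, mul_nonneg (mul_nonneg hc h1) h1, mul_nonneg hc h0]

/-- A term that is negligible compared to the left-hand side can be dropped from a bound. -/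
theorem isBigO_absorb {X F Z : α → ℝ} (h : X =O[l] fun x => F x + Z x) (hZ : Z =o[l] X) :
    X =O[l] F := by
  obtain ⟨c, hc, hb⟩ := h.exists_nonneg
  refine IsBigO.of_bound (2 * c) ?_
  filter_upwards [hb.bound, hZ.bound (by positivity : 0 < 1 / (2 * (c + 1)))] with x h1 h2
  have h3 := mul_le_mul_of_nonneg_left (norm_add_le (F x) (Z x)) hc
  have h4 : c * ‖Z x‖ ≤ 1 / 2 * ‖X x‖ := by
    calc c * ‖Z x‖ ≤ (c + 1) * (1 / (2 * (c + 1)) * ‖X x‖) := by gcongr; linarith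
      _ = 1 / 2 * ‖X x‖ := by field_simp
  linarith

theorem isBigO_of_nonneg_of_le {f g : α → ℝ} (hf : ∀ x, 0 ≤ f x) (h : ∀ x, f x ≤ g x) :
    f =O[l] g :=
  isBigO_of_le l fun x => by
    rw [Real.norm_of_nonneg (hf x), Real.norm_of_nonneg ((hf x).trans (h x))]
    exact h x

/-- Second-order Taylor estimate with a moving base point. -/
theorem isBigO_taylor {E F : Type*} [NormedAddCommGroup E] [NormedSpace ℝ E]
    [NormedAddCommGroup F] [NormedSpace ℝ F] {f : E → F} {f' : E → E →L[ℝ] F} {c : E}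
    (hf : ∀ x, HasFDerivAt f (f' x) x) {K : ℝ≥0} {U : Set E} (hU : U ∈ 𝓝 c)
    (hlip : LipschitzOnWith K f' U) {x y : α → E} (hx : Tendsto x l (𝓝 c))
    (hy : Tendsto y l (𝓝 c)) :
    (fun t => f (y t) - f (x t) - f' (x t) (y t - x t)) =O[l] fun t => ‖y t - x t‖ ^ 2 := by
  obtain ⟨r, hr, hrU⟩ := Metric.mem_nhds_iff.1 hU
  refine IsBigO.of_bound K ?_
  filter_upwards [hx (Metric.ball_mem_nhds c hr), hy (Metric.ball_mem_nhds c hr)] with t h1 h2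
  have hseg : segment ℝ (x t) (y t) ⊆ U := ((convex_ball c r).segment_subset h1 h2).trans hrU
  have := (convex_segment (𝕜 := ℝ) (x t) (y t)).norm_image_sub_le_of_norm_hasFDerivWithin_le'
    (f := f) (f' := f') (φ := f' (x t)) (C := K * ‖y t - x t‖)
    (fun w _ => (hf w).hasFDerivWithinAt)
    (fun w hw => by
      refine (hlip.norm_sub_le (hseg hw) (hseg (left_mem_segment ℝ _ _))).trans ?_
      gcongr
      have := segment_subset_closedBall_left (x t) (y t) hw
      rw [Metric.mem_closedBall, dist_eq_norm, dist_eq_norm] at this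
      rwa [norm_sub_rev (y t)])
    (left_mem_segment ℝ _ _) (right_mem_segment ℝ _ _)
  rw [norm_pow, norm_norm, sq, ← mul_assoc]
  exact this

end Asymptotics

namespace NLP

section Smoothness

variable {n m : ℕ} (P : NLP n m) {α : Type*} {l : Filter α}

theorem Lz_eq (z : Fin n → ℝ) (lam : Fin m → ℝ) :
    P.Lz z lam = P.gradphi z + ∑ i, lam i • P.gradg i z := by
  ext j
  simp [Lz]

theorem Lz_sub_Lz (z : Fin n → ℝ) (lam lam' : Fin m → ℝ) :
    P.Lz z lam - P.Lz z lam' = ∑ i, (lam i - lam' i) • P.gradg i z := by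
  simp [Lz_eq, sub_smul]

theorem matCLM_Lzz (z : Fin n → ℝ) (lam : Fin m → ℝ) :
    matCLM (P.Lzz z lam) = matCLM (P.hessphi z) + ∑ i, lam i • matCLM (P.hessg i z) := by
  ext v i
  simp [matCLM_apply, Lzz, Matrix.add_mulVec, Matrix.sum_mulVec, Matrix.smul_mulVec]

theorem lipschitz_matCLM {H : (Fin n → ℝ) → Matrix (Fin n) (Fin n) ℝ} {K : ℝ}
    (h : ∀ z z', mnorm (H z - H z') ≤ K * evnorm (z - z')) :
    ∃ L : ℝ≥0, LipschitzWith L fun z => matCLM (H z) := by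
  refine ⟨Real.toNNReal (n * (|K| * n)), LipschitzWith.of_dist_le_mul fun z z' => ?_⟩
  rw [Real.coe_toNNReal _ (by positivity), dist_eq_norm, dist_eq_norm, ← matCLM_sub]
  refine (norm_matCLM_le _).trans ?_
  rw [mul_assoc, mul_assoc]
  gcongr
  refine (h z z').trans ?_
  have := evnorm_le_card_mul_norm (z - z')
  rw [Fintype.card_fin] at this
  exact mul_le_mul (le_abs_self K) this (evnorm_nonneg _) (abs_nonneg K)

theorem lipschitz_hessphi : ∃ L : ℝ≥0, LipschitzWith L fun z => matCLM (P.hessphi z) :=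
  P.lip_phi.elim fun _ h => lipschitz_matCLM h

theorem lipschitz_hessg (i : Fin m) : ∃ L : ℝ≥0, LipschitzWith L fun z => matCLM (P.hessg i z) :=
  (P.lip_g i).elim fun _ h => lipschitz_matCLM h

theorem exists_lipschitzOnWith_gradg (i : Fin m) (c : Fin n → ℝ) :
    ∃ K : ℝ≥0, ∃ U ∈ 𝓝 c, LipschitzOnWith K (P.gradg i) U := by
  obtain ⟨L, hL⟩ := P.lipschitz_hessg i
  exact (hasStrictFDerivAt_of_hasFDerivAt_of_continuousAt
    (Eventually.of_forall (P.hess_g i)) hL.continuous.continuousAt).exists_lipschitzOnWith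

variable {c : Fin n → ℝ} {x y : α → Fin n → ℝ}

theorem gradg_sub_isBigO (i : Fin m) (hx : Tendsto x l (𝓝 c)) (hy : Tendsto y l (𝓝 c)) :
    (fun t => P.gradg i (y t) - P.gradg i (x t)) =O[l] fun t => ‖y t - x t‖ := by
  obtain ⟨K, U, hU, hK⟩ := P.exists_lipschitzOnWith_gradg i c
  refine IsBigO.of_bound K ?_
  filter_upwards [hx hU, hy hU] with t h1 h2
  rw [_root_.norm_norm]
  exact hK.norm_sub_le h2 h1

theorem g_taylor (i : Fin m) (hx : Tendsto x l (𝓝 c)) (hy : Tendsto y l (𝓝 c)) :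
    (fun t => P.g i (y t) - P.g i (x t) - P.gradg i (x t) ⬝ᵥ (y t - x t)) =O[l]
      fun t => ‖y t - x t‖ ^ 2 := by
  obtain ⟨K, U, hU, hK⟩ := P.exists_lipschitzOnWith_gradg i c
  have hlip : LipschitzOnWith (n * K) (fun z => dotCLM (P.gradg i z)) U :=
    LipschitzOnWith.of_dist_le_mul fun z hz z' hz' => by
      rw [dist_eq_norm, NNReal.coe_mul, mul_assoc]
      refine (norm_dotCLM_sub_le _ _).trans ?_
      rw [← dist_eq_norm]
      exact mul_le_mul_of_nonneg_left (hK.dist_le_mul z hz z' hz') (Nat.cast_nonneg n)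
  simpa only [dotCLM_apply] using isBigO_taylor (P.grad_g i) hU hlip hx hy

theorem g_taylor' (i : Fin m) (hx : Tendsto x l (𝓝 c)) (hy : Tendsto y l (𝓝 c)) :
    (fun t => P.gradg i (y t) ⬝ᵥ (y t - x t) - (P.g i (y t) - P.g i (x t))) =O[l]
      fun t => ‖y t - x t‖ ^ 2 := by
  have h := (P.g_taylor i hy hx)
  refine (h.congr_right fun t => by rw [norm_sub_rev]).congr_left fun t => ?_
  rw [← neg_sub (y t) (x t), dotProduct_neg]
  ring

theorem Lz_taylor {lam : α → Fin m → ℝ} (hx : Tendsto x l (𝓝 c)) (hy : Tendsto y l (𝓝 c))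
    (hlam : lam =O[l] fun _ => (1 : ℝ)) :
    (fun t => P.Lz (y t) (lam t) - P.Lz (x t) (lam t) -
      (P.Lzz (x t) (lam t)).mulVec (y t - x t)) =O[l] fun t => ‖y t - x t‖ ^ 2 := by
  obtain ⟨L, hL⟩ := P.lipschitz_hessphi
  have h0 := isBigO_taylor P.hess_phi univ_mem hL.lipschitzOnWith hx hy
  have hg : ∀ i, (fun t => lam t i • (P.gradg i (y t) - P.gradg i (x t) -
      matCLM (P.hessg i (x t)) (y t - x t))) =O[l] fun t => ‖y t - x t‖ ^ 2 := fun i => by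
    obtain ⟨L, hL⟩ := P.lipschitz_hessg i
    have h1 := isBigO_taylor (P.hess_g i) univ_mem hL.lipschitzOnWith hx hy
    simpa using (isBigO_pi.1 hlam i).smul h1
  refine (h0.add (IsBigO.sum (s := Finset.univ) fun i _ => hg i)).congr_left fun t => ?_
  rw [← matCLM_apply, matCLM_Lzz]
  simp only [Lz_eq, Finset.sum_apply, smul_sub, Finset.sum_sub_distrib,
    _root_.add_apply, _root_.sum_apply, _root_.smul_apply]
  abel

theorem tendsto_matCLM_Lzz {lam : α → Fin m → ℝ} {lbar : Fin m → ℝ} (hx : Tendsto x l (𝓝 c))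
    (hlam : Tendsto lam l (𝓝 lbar)) :
    Tendsto (fun t => matCLM (P.Lzz (x t) (lam t))) l (𝓝 (matCLM (P.Lzz c lbar))) := by
  simp only [matCLM_Lzz]
  obtain ⟨L, hL⟩ := P.lipschitz_hessphi
  refine ((hL.continuous.tendsto c).comp hx).add (tendsto_finsetSum _ fun i _ => ?_)
  obtain ⟨L, hL⟩ := P.lipschitz_hessg i
  exact ((tendsto_pi_nhds.1 hlam) i).smul ((hL.continuous.tendsto c).comp hx)

theorem Lzz_quadratic_isLittleO {lam : α → Fin m → ℝ} {lbar : Fin m → ℝ}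
    (hx : Tendsto x l (𝓝 c)) (hlam : Tendsto lam l (𝓝 lbar)) (w : α → Fin n → ℝ) :
    (fun t => w t ⬝ᵥ (P.Lzz (x t) (lam t)).mulVec (w t) - w t ⬝ᵥ (P.Lzz c lbar).mulVec (w t))
      =o[l] fun t => ‖w t‖ ^ 2 := by
  have h := (tendsto_iff_norm_sub_tendsto_zero.1 (P.tendsto_matCLM_Lzz hx hlam)).const_mul (n : ℝ)
  rw [mul_zero, ← isLittleO_one_iff ℝ] at h
  have h2 := h.mul_isBigO (isBigO_refl (fun t => ‖w t‖ ^ 2) l)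
  simp only [one_mul] at h2
  refine IsBigO.trans_isLittleO (IsBigO.of_bound 1 (Eventually.of_forall fun t => ?_)) h2
  rw [one_mul, Real.norm_of_nonneg (by positivity :
    0 ≤ n * ‖matCLM (P.Lzz (x t) (lam t)) - matCLM (P.Lzz c lbar)‖ * ‖w t‖ ^ 2),
    ← dotProduct_sub, ← sub_mulVec, ← matCLM_apply, matCLM_sub]
  refine (abs_dotProduct_le _ _).trans ?_
  rw [Fintype.card_fin, mul_assoc]
  have := mul_le_mul_of_nonneg_left ((matCLM (P.Lzz (x t) (lam t)) -
    matCLM (P.Lzz c lbar)).le_opNorm (w t)) (norm_nonneg (w t))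
  refine mul_le_mul_of_nonneg_left ?_ (Nat.cast_nonneg n)
  linarith

end Smoothness

section Multipliers

variable {n m : ℕ} (P : NLP n m) {zstar : Fin n → ℝ}

/-- The active set at `zstar`, as a finite set of indices. -/
def active (zstar : Fin n → ℝ) : Finset (Fin m) :=
  Finset.univ.filter fun i => P.g i zstar = 0

variable {P}

theorem mem_active {i : Fin m} : i ∈ P.active zstar ↔ P.g i zstar = 0 := by
  simp [active]

theorem Slam_eq_zero {ls : Fin m → ℝ} (h : ls ∈ P.Slam zstar) {i : Fin m}
    (hi : i ∉ P.active zstar) : ls i = 0 := by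
  obtain ⟨-, hg, hl, hs⟩ := h
  rw [Finset.sum_eq_zero_iff_of_nonpos
    fun i _ => mul_nonpos_of_nonneg_of_nonpos (hl i) (hg i)] at hs
  exact (mul_eq_zero.1 (hs i (Finset.mem_univ i))).resolve_right fun h => hi (mem_active.2 h)

theorem g_neg_of_notMem_active (hsol : P.isSolution zstar) {i : Fin m}
    (hi : i ∉ P.active zstar) : P.g i zstar < 0 :=
  lt_of_le_of_ne (hsol.1 i) fun h => hi (mem_active.2 h)

variable (P) in
theorem convex_Slam (zstar : Fin n → ℝ) : Convex ℝ (P.Slam zstar) := by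
  intro u hu v hv a b ha hb hab
  obtain ⟨h1, h2, h3, h4⟩ := hu
  obtain ⟨h1', -, h3', h4'⟩ := hv
  refine ⟨?_, h2, fun i => ?_, ?_⟩
  · have : P.Lz zstar (a • u + b • v) = a • P.Lz zstar u + b • P.Lz zstar v := by
      ext j
      have e : ∑ i, (a * u i + b * v i) * P.gradg i zstar j =
          a * ∑ i, u i * P.gradg i zstar j + b * ∑ i, v i * P.gradg i zstar j := by
        rw [Finset.mul_sum, Finset.mul_sum, ← Finset.sum_add_distrib]
        exact Finset.sum_congr rfl fun i _ => by ring
      simp only [Lz, Pi.add_apply, Pi.smul_apply, smul_eq_mul, e]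
      linear_combination -P.gradphi zstar j * hab
    rw [this, h1, h1', smul_zero, smul_zero, add_zero]
  · exact add_nonneg (mul_nonneg ha (h3 i)) (mul_nonneg hb (h3' i))
  · have : ∑ i, (a • u + b • v) i * P.g i zstar =
        a * ∑ i, u i * P.g i zstar + b * ∑ i, v i * P.g i zstar := by
      rw [Finset.mul_sum, Finset.mul_sum, ← Finset.sum_add_distrib]
      exact Finset.sum_congr rfl fun i _ => by simp; ring
    rw [this, h4, h4', mul_zero, mul_zero, add_zero]

/-- Under strict complementarity some multiplier is positive on the whole active set. -/
theorem exists_pos_multiplier (hsol : P.isSolution zstar) (hsc : P.StrictComp zstar) :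
    ∃ ls ∈ P.Slam zstar, ∀ i ∈ P.active zstar, 0 < ls i := by
  suffices ∀ T : Finset (Fin m), T ⊆ P.active zstar →
      ∃ ls ∈ P.Slam zstar, ∀ i ∈ T, 0 < ls i from this _ subset_rfl
  intro T
  induction T using Finset.induction_on with
  | empty => exact fun _ => hsol.2.1.elim fun ls h => ⟨ls, h, by simp⟩
  | insert i T _ ih =>
    intro hT
    obtain ⟨u, hu, hpos⟩ := ih ((Finset.subset_insert i T).trans hT)
    obtain ⟨-, v, hv, hvi⟩ := hsc i (mem_active.1 (hT (Finset.mem_insert_self i T)))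
    refine ⟨(1 / 2 : ℝ) • u + (1 / 2 : ℝ) • v,
      P.convex_Slam zstar hu hv (by norm_num) (by norm_num) (by norm_num), fun j hj => ?_⟩
    have hu0 := hu.2.2.1 j
    have hv0 := hv.2.2.1 j
    simp only [Pi.add_apply, Pi.smul_apply, smul_eq_mul]
    rcases Finset.mem_insert.1 hj with rfl | hj
    · linarith
    · linarith [hpos j hj]

/-- Positive multipliers are dense in the multiplier set. -/
theorem exists_pos_multiplier_near (hsol : P.isSolution zstar) (hsc : P.StrictComp zstar)
    {lbar : Fin m → ℝ} (hl : lbar ∈ P.Slam zstar) {ε : ℝ} (hε : 0 < ε) :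
    ∃ ls ∈ P.Slam zstar, (∀ i ∈ P.active zstar, 0 < ls i) ∧ ‖ls - lbar‖ < ε := by
  obtain ⟨u, hu, hpos⟩ := exists_pos_multiplier hsol hsc
  have hcont : Tendsto (fun t : ℝ => (1 - t) • lbar + t • u) (𝓝[>] 0) (𝓝 lbar) := by
    have : Continuous fun t : ℝ => (1 - t) • lbar + t • u := by fun_prop
    simpa using (this.tendsto 0).mono_left nhdsWithin_le_nhds
  have h1 : ∀ᶠ t in 𝓝[>] (0 : ℝ), t ∈ Set.Ioo (0 : ℝ) 1 := Ioo_mem_nhdsGT one_pos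
  obtain ⟨t, ht, ht0, ht1⟩ := ((hcont.eventually (Metric.ball_mem_nhds lbar hε)).and h1).exists
  refine ⟨(1 - t) • lbar + t • u,
    P.convex_Slam zstar hl hu (by linarith : (0 : ℝ) ≤ 1 - t) ht0.le (by ring),
    fun i hi => ?_, ?_⟩
  · have := mul_pos ht0 (hpos i hi)
    have := mul_nonneg (by linarith : 0 ≤ 1 - t) (hl.2.2.1 i)
    simp only [Pi.add_apply, Pi.smul_apply, smul_eq_mul]
    linarith
  · rw [← dist_eq_norm]
    exact ht

theorem isCompact_Slam (hmfcq : P.MFCQ zstar) : IsCompact (P.Slam zstar) := by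
  obtain ⟨y, hy⟩ := hmfcq
  have hclosed : IsClosed (P.Slam zstar) := by
    have hL : Continuous fun ls => P.Lz zstar ls := by
      unfold Lz
      fun_prop
    exact (isClosed_eq hL continuous_const).inter (IsClosed.inter isClosed_const
      ((isClosed_Ici (a := (0 : Fin m → ℝ))).inter (isClosed_eq (by fun_prop) continuous_const)))
  refine (isCompact_Icc (a := (0 : Fin m → ℝ)) (b := fun i => if P.g i zstar = 0 then
    (P.gradphi zstar ⬝ᵥ y) / -(P.gradg i zstar ⬝ᵥ y) else 0)).of_isClosed_subset hclosed ?_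
  intro ls hls
  refine ⟨fun i => hls.2.2.1 i, fun i => ?_⟩
  by_cases hi : P.g i zstar = 0
  · have h_neg : P.gradg i zstar ⬝ᵥ y < 0 := hy i hi
    simp only [hi, if_true]
    rw [le_div_iff₀ (by linarith)]
    have h0 : (P.gradphi zstar + ∑ i, ls i • P.gradg i zstar) ⬝ᵥ y = 0 := by
      rw [← Lz_eq, hls.1, zero_dotProduct]
    rw [add_dotProduct, sum_dotProduct] at h0
    simp only [smul_dotProduct, smul_eq_mul] at h0
    have hle : ∀ j ∈ Finset.univ, 0 ≤ -(ls j * (P.gradg j zstar ⬝ᵥ y)) := fun j _ => by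
      by_cases hj : P.g j zstar = 0
      · have : P.gradg j zstar ⬝ᵥ y < 0 := hy j hj
        nlinarith [hls.2.2.1 j]
      · rw [Slam_eq_zero hls (fun h => hj (mem_active.1 h))]
        simp
    have := Finset.single_le_sum hle (Finset.mem_univ i)
    rw [Finset.sum_neg_distrib] at this
    linarith
  · simp only [hi, if_false]
    exact (Slam_eq_zero hls (fun h => hi (mem_active.1 h))).le

/-- Under strict complementarity, the second-order condition makes the Hessian of the Lagrangian
positive definite up to a quadratic penalty on the active constraints. -/
theorem exists_Lzz_penalty (hsoc : P.SOC zstar) (hsc : P.StrictComp zstar) :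
    ∃ ξ : ℝ, 0 < ξ ∧ ∀ ls ∈ P.Slam zstar, ∃ C : ℝ, 0 ≤ C ∧ ∀ w : Fin n → ℝ,
      ξ * ‖w‖ ^ 2 ≤ w ⬝ᵥ (P.Lzz zstar ls).mulVec w +
        C * ∑ i ∈ P.active zstar, (P.gradg i zstar ⬝ᵥ w) ^ 2 := by
  obtain ⟨ξ, hξ, h⟩ := hsoc
  refine ⟨ξ / 2, by positivity, fun ls hls => exists_penalty _ _ _ hξ fun w hw => ?_⟩
  rw [← evnorm_sq]
  exact h ls hls w (fun i hi => hw i (mem_active.2 hi.1)) fun i hi hni => absurd (hsc i hi) hni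

end Multipliers

end NLP

namespace NLP

section Iterates

variable {n m : ℕ}

/-- The linear map `v ↦ ∇g_B(z*) v_B`. -/
def activeMap (P : NLP n m) (zstar : Fin n → ℝ) : (Fin m → ℝ) →ₗ[ℝ] (Fin n → ℝ) :=
  ∑ i ∈ P.active zstar, (LinearMap.proj i).smulRight (P.gradg i zstar)

theorem activeMap_apply (P : NLP n m) (zstar : Fin n → ℝ) (v : Fin m → ℝ) :
    P.activeMap zstar v = ∑ i ∈ P.active zstar, v i • P.gradg i zstar := by
  simp [activeMap]

/-- A family of approximately central iterates approaching `(zstar, lbar)`, with duality measure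
`mu` tending to zero. -/
structure IterateFamily (P : NLP n m) (zstar : Fin n → ℝ) (lbar : Fin m → ℝ) (C gam : ℝ)
    {α : Type*} (l : Filter α) (mu : α → ℝ) (z : α → Fin n → ℝ) (lam s : α → Fin m → ℝ) :
    Prop where
  mu_eq : ∀ x, mu x = dmu (lam x) (s x)
  tendsto_z : Tendsto z l (𝓝 zstar)
  tendsto_lam : Tendsto lam l (𝓝 lbar)
  tendsto_mu : Tendsto mu l (𝓝 0)
  central : ∀ x, P.central C gam (z x) (lam x) (s x)

namespace IterateFamily

variable {P : NLP n m} {zstar : Fin n → ℝ} {lbar : Fin m → ℝ} {C gam : ℝ} {α : Type*}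
  {l : Filter α} {mu : α → ℝ} {z : α → Fin n → ℝ} {lam s : α → Fin m → ℝ}

theorem lam_pos (h : IterateFamily P zstar lbar C gam l mu z lam s) (x : α) (i : Fin m) :
    0 < lam x i := (h.central x).2.2.1 i

theorem s_pos (h : IterateFamily P zstar lbar C gam l mu z lam s) (x : α) (i : Fin m) :
    0 < s x i := (h.central x).2.2.2.1 i

theorem le_lam_mul_s (h : IterateFamily P zstar lbar C gam l mu z lam s) (x : α) (i : Fin m) :
    gam * mu x ≤ lam x i * s x i := by
  rw [h.mu_eq]
  exact (h.central x).2.2.2.2 i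

theorem mu_nonneg (h : IterateFamily P zstar lbar C gam l mu z lam s) (x : α) : 0 ≤ mu x := by
  rw [h.mu_eq]
  exact div_nonneg (Finset.sum_nonneg fun i _ => (mul_pos (h.lam_pos x i) (h.s_pos x i)).le)
    (Nat.cast_nonneg m)

theorem mu_pos (h : IterateFamily P zstar lbar C gam l mu z lam s) (i : Fin m) (x : α) :
    0 < mu x := by
  have : Nonempty (Fin m) := ⟨i⟩
  rw [h.mu_eq]
  exact div_pos (Finset.sum_pos (fun i _ => mul_pos (h.lam_pos x i) (h.s_pos x i))
    Finset.univ_nonempty) (Nat.cast_pos.2 (Fin.pos i))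

theorem mu_isLittleO (h : IterateFamily P zstar lbar C gam l mu z lam s) :
    mu =o[l] fun _ => (1 : ℝ) := (isLittleO_one_iff ℝ).2 h.tendsto_mu

theorem mu_isBigO_one (h : IterateFamily P zstar lbar C gam l mu z lam s) :
    mu =O[l] fun _ => (1 : ℝ) := h.mu_isLittleO.isBigO

theorem dist_isLittleO (h : IterateFamily P zstar lbar C gam l mu z lam s) :
    (fun x => ‖z x - zstar‖) =o[l] fun _ => (1 : ℝ) :=
  (isLittleO_one_iff ℝ).2 (tendsto_iff_norm_sub_tendsto_zero.1 h.tendsto_z)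

theorem isBigO_mu_of_evnorm_le {ι : Type*} [Fintype ι]
    (h : IterateFamily P zstar lbar C gam l mu z lam s) {f : α → ι → ℝ}
    (hf : ∀ x, evnorm (f x) ≤ C * dmu (lam x) (s x)) : f =O[l] mu :=
  IsBigO.of_bound C (Eventually.of_forall fun x => by
    rw [Real.norm_of_nonneg (h.mu_nonneg x), h.mu_eq]
    exact (norm_le_evnorm _).trans (hf x))

theorem Lz_isBigO (h : IterateFamily P zstar lbar C gam l mu z lam s) :
    (fun x => P.Lz (z x) (lam x)) =O[l] mu :=
  h.isBigO_mu_of_evnorm_le fun x => (h.central x).1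

theorem residual_isBigO (h : IterateFamily P zstar lbar C gam l mu z lam s) (i : Fin m) :
    (fun x => P.g i (z x) + s x i) =O[l] mu :=
  isBigO_pi.1 (h.isBigO_mu_of_evnorm_le (f := fun x i => P.g i (z x) + s x i)
    fun x => (h.central x).2.1) i

theorem lam_isBigO_one (h : IterateFamily P zstar lbar C gam l mu z lam s) :
    lam =O[l] fun _ => (1 : ℝ) := h.tendsto_lam.isBigO_one ℝ

theorem lam_mul_s_isBigO (h : IterateFamily P zstar lbar C gam l mu z lam s) (i : Fin m) :
    (fun x => lam x i * s x i) =O[l] mu := by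
  refine IsBigO.of_bound m (Eventually.of_forall fun x => ?_)
  have hp : ∀ j, 0 < lam x j * s x j := fun j => mul_pos (h.lam_pos x j) (h.s_pos x j)
  have hm : (m : ℝ) ≠ 0 := by
    have := Fin.pos i
    positivity
  rw [Real.norm_of_nonneg (h.mu_nonneg x), Real.norm_of_nonneg (hp i).le, h.mu_eq, dmu,
    mul_div_cancel₀ _ hm]
  exact Finset.single_le_sum (f := fun j => lam x j * s x j) (fun j _ => (hp j).le)
    (Finset.mem_univ i)

theorem gradg_isBigO_one (h : IterateFamily P zstar lbar C gam l mu z lam s) (i : Fin m) :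
    (fun x => P.gradg i (z x)) =O[l] fun _ => (1 : ℝ) :=
  (((P.hess_g i zstar).continuousAt.tendsto).comp h.tendsto_z).isBigO_one ℝ

theorem gradg_sub_isBigO (h : IterateFamily P zstar lbar C gam l mu z lam s) (i : Fin m) :
    (fun x => P.gradg i (z x) - P.gradg i zstar) =O[l] fun x => ‖z x - zstar‖ :=
  P.gradg_sub_isBigO i tendsto_const_nhds h.tendsto_z

theorem tendsto_s (h : IterateFamily P zstar lbar C gam l mu z lam s) (i : Fin m) :
    Tendsto (fun x => s x i) l (𝓝 (-P.g i zstar)) := by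
  have h1 := (h.residual_isBigO i).trans_tendsto h.tendsto_mu
  have h2 := ((P.grad_g i zstar).continuousAt.tendsto).comp h.tendsto_z
  simpa using h1.sub h2

theorem inv_s_isBigO_one (h : IterateFamily P zstar lbar C gam l mu z lam s)
    (hsol : P.isSolution zstar) {i : Fin m} (hi : i ∉ P.active zstar) :
    (fun x => (s x i)⁻¹) =O[l] fun _ => (1 : ℝ) :=
  ((h.tendsto_s i).inv₀ (neg_ne_zero.2 (g_neg_of_notMem_active hsol hi).ne)).isBigO_one ℝ

theorem lam_inactive_isBigO (h : IterateFamily P zstar lbar C gam l mu z lam s)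
    (hsol : P.isSolution zstar) {i : Fin m} (hi : i ∉ P.active zstar) :
    (fun x => lam x i) =O[l] mu := by
  have := (h.lam_mul_s_isBigO i).mul (h.inv_s_isBigO_one hsol hi)
  refine this.congr (fun x => ?_) fun x => mul_one _
  rw [mul_assoc, mul_inv_cancel₀ (h.s_pos x i).ne', mul_one]

/-- Slacks of active constraints are of the order of the duality measure. -/
theorem s_active_isBigO (h : IterateFamily P zstar lbar C gam l mu z lam s)
    (hsol : P.isSolution zstar) (hsoc : P.SOC zstar) (hsc : P.StrictComp zstar)
    (hl : lbar ∈ P.Slam zstar) {j : Fin m} (hj : j ∈ P.active zstar) :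
    (fun x => s x j) =O[l] mu := by
  obtain ⟨ξ, hξ, hpen⟩ := exists_Lzz_penalty hsoc hsc
  have hz0 : Tendsto (fun _ : α => zstar) l (𝓝 zstar) := tendsto_const_nhds
  let e : α → Fin m → ℝ := fun x i =>
    P.gradg i (z x) ⬝ᵥ (z x - zstar) - (P.g i (z x) - P.g i zstar)
  have he : e =O[l] fun x => ‖z x - zstar‖ ^ 2 :=
    isBigO_pi.2 fun i => P.g_taylor' i hz0 h.tendsto_z
  obtain ⟨K, hK, heK⟩ := he.exists_nonneg
  obtain ⟨lh, hlh, hpos, hnear⟩ := exists_pos_multiplier_near hsol hsc hl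
    (by positivity : 0 < ξ / (8 * (m + 1) * (K + 1)))
  set η : ℝ := ξ / (8 * (m + 1) * (K + 1)) with hη
  have hη0 : 0 < η := by positivity
  have hηK : m * (η * K) ≤ ξ / 8 := by
    have : ξ / 8 = (m + 1) * (η * (K + 1)) := by
      rw [hη]
      field_simp
    rw [this]
    gcongr <;> linarith
  obtain ⟨Cp, hCp, hpen⟩ := hpen lh hlh
  have hlam : ∀ᶠ x in l, ‖lam x - lh‖ < η := by
    have : Tendsto (fun x => ‖lam x - lh‖) l (𝓝 ‖lbar - lh‖) :=
      (h.tendsto_lam.sub tendsto_const_nhds).norm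
    rw [norm_sub_rev] at hnear
    exact this.eventually_lt_const hnear
  let R : α → Fin n → ℝ := fun x =>
    P.Lz (z x) lh - P.Lz zstar lh - (P.Lzz zstar lh).mulVec (z x - zstar)
  have hR : R =O[l] fun x => ‖z x - zstar‖ ^ 2 :=
    P.Lz_taylor hz0 h.tendsto_z (isBigO_const_const lh one_ne_zero l)
  have hδ : (fun x => z x - zstar) =O[l] fun x => ‖z x - zstar‖ := (isBigO_refl _ _).norm_right
  have hδR : (fun x => (z x - zstar) ⬝ᵥ R x) =o[l] fun x => ‖z x - zstar‖ ^ 2 := by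
    refine (hδ.dotProduct hR).trans_isLittleO ?_
    simpa using h.dist_isLittleO.mul_isBigO (isBigO_refl (fun x => ‖z x - zstar‖ ^ 2) l)
  have hδ1 : (fun x => z x - zstar) =O[l] fun _ => (1 : ℝ) := hδ.trans h.dist_isLittleO.isBigO
  let T : α → ℝ := fun x => (z x - zstar) ⬝ᵥ P.Lz (z x) (lam x)
    - ∑ i ∈ P.active zstar, (lam x i - lh i) * (P.g i (z x) + s x i)
    + ∑ i ∈ P.active zstar, lam x i * s x i
    - ∑ i ∈ (P.active zstar)ᶜ, lam x i * (P.gradg i (z x) ⬝ᵥ (z x - zstar))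
    + 3 * Cp * ∑ i ∈ P.active zstar, (P.g i (z x) + s x i) ^ 2
  have hT : T =O[l] mu := by
    have t1 := (hδ1.dotProduct h.Lz_isBigO).trans (isBigO_of_le l fun x => by rw [one_mul])
    have t2 : ∀ i, (fun x => (lam x i - lh i) * (P.g i (z x) + s x i)) =O[l] mu := fun i => by
      have := ((isBigO_pi.1 h.lam_isBigO_one i).sub
        (isBigO_const_const (lh i) (one_ne_zero (α := ℝ)) l)).mul (h.residual_isBigO i)
      simpa using this
    have t4 : ∀ i ∈ (P.active zstar)ᶜ,
        (fun x => lam x i * (P.gradg i (z x) ⬝ᵥ (z x - zstar))) =O[l] mu := fun i hi => by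
      have := (h.lam_inactive_isBigO hsol (Finset.mem_compl.1 hi)).mul
        ((h.gradg_isBigO_one i).dotProduct hδ1)
      simpa using this
    have t5 : ∀ i, (fun x => (P.g i (z x) + s x i) ^ 2) =O[l] mu := fun i => by
      have := (h.residual_isBigO i).mul ((h.residual_isBigO i).trans h.mu_isBigO_one)
      simpa [sq] using this
    exact ((((t1.sub (IsBigO.fun_sum fun i _ => t2 i)).add
      (IsBigO.fun_sum fun i _ => h.lam_mul_s_isBigO i)).sub (IsBigO.fun_sum t4)).add
      ((IsBigO.fun_sum fun i _ => t5 i).const_mul_left _))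
  let e' : Fin m → α → ℝ := fun i x =>
    P.g i (z x) - P.g i zstar - P.gradg i zstar ⬝ᵥ (z x - zstar)
  have he' : (fun x => 3 * Cp * ∑ i ∈ P.active zstar, e' i x ^ 2) =o[l]
      fun x => ‖z x - zstar‖ ^ 2 := by
    refine IsLittleO.const_mul_left (IsLittleO.fun_sum fun i _ => ?_) _
    have h1 : (fun x => ‖z x - zstar‖ ^ 2) =o[l] fun _ => (1 : ℝ) := by
      simpa using h.dist_isLittleO.pow two_pos
    have h2 : e' i =O[l] fun x => ‖z x - zstar‖ ^ 2 := P.g_taylor i hz0 h.tendsto_z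
    simpa [sq] using (h2.trans_isLittleO h1).mul_isBigO h2
  have hsmall : ∀ᶠ x in l, ∀ i ∈ P.active zstar, 3 * Cp * s x i ≤ lh i / 2 := by
    refine (Finset.eventually_all _).2 fun i hi => ?_
    have : Tendsto (fun x => 3 * Cp * s x i) l (𝓝 (3 * Cp * -P.g i zstar)) :=
      (h.tendsto_s i).const_mul _
    rw [mem_active.1 hi, neg_zero, mul_zero] at this
    exact this.eventually_le_const (half_pos (hpos i hi))
  obtain ⟨c, hc⟩ := hT.bound
  refine IsBigO.of_bound (2 * c / lh j) ?_
  filter_upwards [hlam, heK.bound, hδR.bound (by positivity : 0 < ξ / 8),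
    he'.bound (by positivity : 0 < ξ / 8), hsmall, hc] with x h1 h2 h3 h4 h5 h6
  rw [Real.norm_of_nonneg (h.mu_nonneg x)] at h6 ⊢
  rw [Real.norm_of_nonneg (h.s_pos x j).le]
  rw [Real.norm_of_nonneg (sq_nonneg _)] at h2 h3 h4
  have h3 := (abs_le.1 h3).1
  have h4 := (abs_le.1 h4).2
  have h6 := (abs_le.1 h6).2
  have hE : -(ξ / 8 * ‖z x - zstar‖ ^ 2) ≤
      ∑ i ∈ P.active zstar, (lam x i - lh i) * e x i := by
    refine neg_le_of_abs_le ((Finset.abs_sum_le_sum_abs _ _).trans ?_)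
    have hb : ∀ i ∈ P.active zstar,
        |(lam x i - lh i) * e x i| ≤ η * (K * ‖z x - zstar‖ ^ 2) := fun i _ => by
      rw [abs_mul]
      exact mul_le_mul ((norm_le_pi_norm (lam x - lh) i).trans h1.le)
        ((norm_le_pi_norm (e x) i).trans h2) (abs_nonneg _) hη0.le
    refine (Finset.sum_le_card_nsmul _ _ _ hb).trans ?_
    rw [nsmul_eq_mul]
    have hcard : ((P.active zstar).card : ℝ) ≤ m := by
      exact_mod_cast (Finset.card_le_univ _).trans_eq (Fintype.card_fin m)
    calc ((P.active zstar).card : ℝ) * (η * (K * ‖z x - zstar‖ ^ 2))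
        ≤ m * (η * (K * ‖z x - zstar‖ ^ 2)) := by gcongr
      _ = m * (η * K) * ‖z x - zstar‖ ^ 2 := by ring
      _ ≤ _ := by gcongr
  have hquad : (z x - zstar) ⬝ᵥ (P.Lzz zstar lh).mulVec (z x - zstar) =
      (z x - zstar) ⬝ᵥ P.Lz (z x) (lam x) - (z x - zstar) ⬝ᵥ R x
      - ∑ i, (lam x i - lh i) * (P.gradg i (z x) ⬝ᵥ (z x - zstar)) := by
    have hL := P.Lz_sub_Lz (z x) (lam x) lh
    have : (P.Lzz zstar lh).mulVec (z x - zstar) = P.Lz (z x) (lam x) - R x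
        - ∑ i, (lam x i - lh i) • P.gradg i (z x) := by
      simp only [R]
      rw [← hL, hlh.1]
      abel
    rw [this, dotProduct_sub, dotProduct_sub, dotProduct_sum]
    congr 1
    exact Finset.sum_congr rfl fun i _ => by
      rw [dotProduct_smul, smul_eq_mul, dotProduct_comm]
  have hsplit : ∑ i, (lam x i - lh i) * (P.gradg i (z x) ⬝ᵥ (z x - zstar)) =
      ∑ i ∈ P.active zstar, (lam x i - lh i) * (P.g i (z x) + s x i)
      - ∑ i ∈ P.active zstar, lam x i * s x i + ∑ i ∈ P.active zstar, lh i * s x i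
      + ∑ i ∈ P.active zstar, (lam x i - lh i) * e x i
      + ∑ i ∈ (P.active zstar)ᶜ, lam x i * (P.gradg i (z x) ⬝ᵥ (z x - zstar)) := by
    rw [← Finset.sum_add_sum_compl (P.active zstar)]
    congr 1
    · rw [← Finset.sum_sub_distrib, ← Finset.sum_add_distrib, ← Finset.sum_add_distrib]
      refine Finset.sum_congr rfl fun i hi => ?_
      simp only [e, mem_active.1 hi]
      ring
    · refine Finset.sum_congr rfl fun i hi => ?_
      rw [Slam_eq_zero hlh (Finset.mem_compl.1 hi), sub_zero]
  have hsq : Cp * ∑ i ∈ P.active zstar, (P.gradg i zstar ⬝ᵥ (z x - zstar)) ^ 2 ≤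
      3 * Cp * ∑ i ∈ P.active zstar, (P.g i (z x) + s x i) ^ 2
      + 3 * Cp * ∑ i ∈ P.active zstar, e' i x ^ 2
      + ∑ i ∈ P.active zstar, lh i / 2 * s x i := by
    simp only [Finset.mul_sum]
    rw [← Finset.sum_add_distrib, ← Finset.sum_add_distrib]
    refine Finset.sum_le_sum fun i hi => ?_
    have e1 : P.gradg i zstar ⬝ᵥ (z x - zstar) = P.g i (z x) + s x i - s x i - e' i x := by
      simp only [e', mem_active.1 hi]
      ring
    have e2 := mul_le_mul_of_nonneg_right (h5 i hi) (h.s_pos x i).le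
    have e3 : (P.g i (z x) + s x i - s x i - e' i x) ^ 2 ≤
        3 * ((P.g i (z x) + s x i) ^ 2 + s x i ^ 2 + e' i x ^ 2) := by
      nlinarith [sq_nonneg (P.g i (z x) + s x i + s x i),
        sq_nonneg (P.g i (z x) + s x i + e' i x), sq_nonneg (s x i - e' i x)]
    rw [e1]
    have := mul_le_mul_of_nonneg_left e3 hCp
    linarith
  have hfin := hpen (z x - zstar)
  have hhalf : ∑ i ∈ P.active zstar, lh i / 2 * s x i =
      (∑ i ∈ P.active zstar, lh i * s x i) / 2 := by
    rw [Finset.sum_div]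
    exact Finset.sum_congr rfl fun i _ => by ring
  have hsj : lh j * s x j ≤ ∑ i ∈ P.active zstar, lh i * s x i :=
    Finset.single_le_sum (f := fun i => lh i * s x i)
      (fun i hi => (mul_pos (hpos i hi) (h.s_pos x i)).le) hj
  have hd := mul_nonneg hξ.le (sq_nonneg ‖z x - zstar‖)
  simp only [T] at h6
  rw [div_mul_eq_mul_div, le_div_iff₀ (hpos j hj)]
  linarith

end IterateFamily

end Iterates

end NLP

namespace NLP

section Convergence

variable {n m : ℕ} {P : NLP n m} {zstar : Fin n → ℝ} {lbar : Fin m → ℝ} {C gam : ℝ} {α : Type*}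
  {l : Filter α} {mu : α → ℝ} {z : α → Fin n → ℝ} {lam s : α → Fin m → ℝ}

/-- Near a multiplier, `‖w‖²` is controlled by the Hessian quadratic form and the active
constraint values. -/
theorem sq_norm_isBigO_of_quadratic (hsoc : P.SOC zstar) (hsc : P.StrictComp zstar)
    (hl : lbar ∈ P.Slam zstar) (hz : Tendsto z l (𝓝 zstar)) (hlam : Tendsto lam l (𝓝 lbar))
    {w : α → Fin n → ℝ} {F : α → ℝ}
    (hquad : (fun x => w x ⬝ᵥ (P.Lzz (z x) (lam x)).mulVec (w x)) =O[l] F)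
    (hact : ∀ i ∈ P.active zstar, (fun x => (P.gradg i zstar ⬝ᵥ w x) ^ 2) =O[l] F) :
    (fun x => ‖w x‖ ^ 2) =O[l] F := by
  obtain ⟨ξ, hξ, hpen⟩ := exists_Lzz_penalty hsoc hsc
  obtain ⟨Cp, -, hpen⟩ := hpen lbar hl
  have hdiff := P.Lzz_quadratic_isLittleO hz hlam w
  have h1 : (fun x => ξ * ‖w x‖ ^ 2) =O[l] fun x =>
      (w x ⬝ᵥ (P.Lzz (z x) (lam x)).mulVec (w x) +
        Cp * ∑ i ∈ P.active zstar, (P.gradg i zstar ⬝ᵥ w x) ^ 2) +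
      -(w x ⬝ᵥ (P.Lzz (z x) (lam x)).mulVec (w x) - w x ⬝ᵥ (P.Lzz zstar lbar).mulVec (w x)) :=
    isBigO_of_nonneg_of_le (fun x => by positivity) fun x => by linarith [hpen (w x)]
  have h2 := isBigO_absorb ((isBigO_const_mul_left_iff hξ.ne').1 h1) hdiff.neg_left
  exact h2.trans (hquad.add ((IsBigO.fun_sum hact).const_mul_left _))

namespace IterateFamily

theorem inv_lam_isBigO_one (h : IterateFamily P zstar lbar C gam l mu z lam s) (hgam : 0 < gam)
    (hsol : P.isSolution zstar) (hsoc : P.SOC zstar) (hsc : P.StrictComp zstar)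
    (hl : lbar ∈ P.Slam zstar) {i : Fin m} (hi : i ∈ P.active zstar) :
    (fun x => (lam x i)⁻¹) =O[l] fun _ => (1 : ℝ) := by
  obtain ⟨K, hK, hs⟩ := (h.s_active_isBigO hsol hsoc hsc hl hi).exists_nonneg
  refine IsBigO.of_bound (K / gam) (hs.bound.mono fun x hx => ?_)
  have hm := h.mu_pos i x
  have hp := h.lam_pos x i
  rw [Real.norm_of_nonneg hm.le, Real.norm_of_nonneg (h.s_pos x i).le] at hx
  rw [norm_one, mul_one, Real.norm_of_nonneg (inv_nonneg.2 hp.le), inv_eq_one_div,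
    div_le_div_iff₀ hp hgam, one_mul]
  refine le_of_mul_le_mul_right ?_ hm
  have := mul_le_mul_of_nonneg_left hx hp.le
  linarith [h.le_lam_mul_s x i]

/-- The iterates approach `zstar` at least as fast as the duality measure tends to zero. -/
theorem dist_isBigO (h : IterateFamily P zstar lbar C gam l mu z lam s)
    (hsol : P.isSolution zstar) (hsoc : P.SOC zstar) (hsc : P.StrictComp zstar)
    (hl : lbar ∈ P.Slam zstar) : (fun x => ‖z x - zstar‖) =O[l] mu := by
  have hz0 : Tendsto (fun _ : α => zstar) l (𝓝 zstar) := tendsto_const_nhds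
  have hmu0 := h.mu_nonneg
  have hmuF : mu =O[l] fun x => mu x + ‖z x - zstar‖ :=
    isBigO_of_nonneg_of_le hmu0 fun x => by linarith [norm_nonneg (z x - zstar)]
  have hdF : (fun x => ‖z x - zstar‖) =O[l] fun x => mu x + ‖z x - zstar‖ :=
    isBigO_of_nonneg_of_le (fun x => norm_nonneg _) fun x => by linarith [hmu0 x]
  have hmuF' : mu =O[l] fun x => mu x + ‖z x - zstar‖ ^ 2 :=
    isBigO_of_nonneg_of_le hmu0 fun x => by linarith [sq_nonneg ‖z x - zstar‖]
  have hdF' : (fun x => ‖z x - zstar‖ ^ 2) =O[l] fun x => mu x + ‖z x - zstar‖ ^ 2 :=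
    isBigO_of_nonneg_of_le (fun x => sq_nonneg _) fun x => by linarith [hmu0 x]
  have hd2d : (fun x => ‖z x - zstar‖ ^ 2) =O[l] fun x => ‖z x - zstar‖ := by
    simpa [sq] using h.dist_isLittleO.isBigO.mul (isBigO_refl (fun x => ‖z x - zstar‖) l)
  have hF'F : (fun x => mu x + ‖z x - zstar‖ ^ 2) =O[l] fun x => mu x + ‖z x - zstar‖ :=
    hmuF.add (hd2d.trans hdF)
  have hδ : (fun x => z x - zstar) =O[l] fun x => ‖z x - zstar‖ := (isBigO_refl _ _).norm_right
  let V : α → Fin n → ℝ := fun x => P.Lz (z x) (lam x) -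
    (P.Lz (z x) (lam x) - P.Lz zstar (lam x) - (P.Lzz zstar (lam x)).mulVec (z x - zstar)) -
    ∑ i ∈ (P.active zstar)ᶜ, lam x i • P.gradg i zstar
  have hV : V =O[l] fun x => mu x + ‖z x - zstar‖ ^ 2 := by
    refine ((h.Lz_isBigO.trans hmuF').sub
      ((P.Lz_taylor hz0 h.tendsto_z h.lam_isBigO_one).trans hdF')).sub
      (IsBigO.fun_sum fun i hi => ?_)
    have := (h.lam_inactive_isBigO hsol (Finset.mem_compl.1 hi)).smul
      (isBigO_const_const (P.gradg i zstar) (one_ne_zero (α := ℝ)) l)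
    exact (this.congr_right fun x => by simp).trans hmuF'
  have hA : ∀ x, P.activeMap zstar (lam x - lbar) =
      V x - (P.Lzz zstar (lam x)).mulVec (z x - zstar) := fun x => by
    have e1 := P.Lz_sub_Lz zstar (lam x) lbar
    rw [hl.1, sub_zero, ← Finset.sum_add_sum_compl (P.active zstar)] at e1
    have e2 : ∑ i ∈ (P.active zstar)ᶜ, (lam x i - lbar i) • P.gradg i zstar =
        ∑ i ∈ (P.active zstar)ᶜ, lam x i • P.gradg i zstar :=
      Finset.sum_congr rfl fun i hi => by rw [Slam_eq_zero hl (Finset.mem_compl.1 hi), sub_zero]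
    rw [e2] at e1
    simp only [activeMap_apply, Pi.sub_apply, V, e1]
    abel
  clear_value V
  obtain ⟨Cp, -, p, hp⟩ := (P.activeMap zstar).exists_bounded_preimage
  have hH : (fun x => (P.Lzz zstar (lam x)).mulVec (z x - zstar)) =O[l]
      fun x => ‖z x - zstar‖ := by
    simpa using ((P.tendsto_matCLM_Lzz hz0 h.tendsto_lam).isBigO_one ℝ).mulVec hδ
  have hpO : (fun x => p (lam x - lbar)) =O[l] fun x => mu x + ‖z x - zstar‖ := by
    refine (IsBigO.of_bound Cp (Eventually.of_forall fun x => ?_)).trans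
      ((hV.trans hF'F).sub (hH.trans hdF))
    rw [← hA]
    exact (hp _).2
  have haδ : ∀ i ∈ P.active zstar, (fun x => P.gradg i zstar ⬝ᵥ (z x - zstar)) =O[l]
      fun x => mu x + ‖z x - zstar‖ ^ 2 := fun i hi => by
    have := (((h.residual_isBigO i).sub (h.s_active_isBigO hsol hsoc hsc hl hi)).trans
      hmuF').sub ((P.g_taylor i hz0 h.tendsto_z).trans hdF')
    refine this.congr_left fun x => ?_
    rw [mem_active.1 hi]
    ring
  have hquad : (fun x => (z x - zstar) ⬝ᵥ (P.Lzz zstar (lam x)).mulVec (z x - zstar)) =O[l]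
      fun x => (mu x + ‖z x - zstar‖) * (mu x + ‖z x - zstar‖ ^ 2) := by
    have := ((hδ.trans hdF).dotProduct hV).sub
      (IsBigO.fun_sum fun i hi => (isBigO_pi.1 hpO i).mul (haδ i hi))
    refine this.congr_left fun x => ?_
    have e1 : (P.Lzz zstar (lam x)).mulVec (z x - zstar) =
        V x - P.activeMap zstar (p (lam x - lbar)) := by rw [(hp _).1, hA]; abel
    rw [e1, activeMap_apply, dotProduct_sub, dotProduct_sum]
    congr 1
    exact Finset.sum_congr rfl fun i _ => by
      rw [dotProduct_smul, smul_eq_mul, dotProduct_comm]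
  have hsq := sq_norm_isBigO_of_quadratic hsoc hsc hl hz0 h.tendsto_lam hquad fun i hi => by
    simpa only [sq] using ((haδ i hi).trans hF'F).mul (haδ i hi)
  have hsmall : (fun x => (mu x + ‖z x - zstar‖) * ‖z x - zstar‖ ^ 2) =o[l]
      fun x => ‖z x - zstar‖ ^ 2 := by
    simpa using (h.mu_isLittleO.add h.dist_isLittleO).mul_isBigO
      (isBigO_refl (fun x => ‖z x - zstar‖ ^ 2) l)
  refine isBigO_of_sq_isBigO (fun x => norm_nonneg _) hmu0
    (isBigO_absorb (hsq.congr_right fun x => ?_) hsmall)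
  ring

end IterateFamily

end Convergence

end NLP

namespace NLP

section Step

variable {n m : ℕ} {P : NLP n m} {zstar : Fin n → ℝ} {lbar : Fin m → ℝ} {C gam Kt : ℝ}
  {α : Type*} {l : Filter α} {mu : α → ℝ} {z : α → Fin n → ℝ} {lam s t : α → Fin m → ℝ}
  {dz : α → Fin n → ℝ} {dl ds : α → Fin m → ℝ}

theorem IterateFamily.g_active_isBigO (h : IterateFamily P zstar lbar C gam l mu z lam s)
    (hsol : P.isSolution zstar) (hsoc : P.SOC zstar) (hsc : P.StrictComp zstar)
    (hl : lbar ∈ P.Slam zstar) {i : Fin m} (hi : i ∈ P.active zstar) :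
    (fun x => P.g i (z x)) =O[l] mu := by
  simpa using (h.residual_isBigO i).sub (h.s_active_isBigO hsol hsoc hsc hl hi)

theorem IterateFamily.ratio_isBigO (h : IterateFamily P zstar lbar C gam l mu z lam s)
    (hgam : 0 < gam) (hsol : P.isSolution zstar) (hsoc : P.SOC zstar) (hsc : P.StrictComp zstar)
    (hl : lbar ∈ P.Slam zstar) {i : Fin m} (hi : i ∈ P.active zstar) :
    (fun x => s x i * (lam x i)⁻¹) =O[l] mu := by
  simpa using (h.s_active_isBigO hsol hsoc hsc hl hi).mul
    (h.inv_lam_isBigO_one hgam hsol hsoc hsc hl hi)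

theorem IterateFamily.isBigO_ratio (h : IterateFamily P zstar lbar C gam l mu z lam s)
    (hgam : 0 < gam) (i : Fin m) : mu =O[l] fun x => s x i * (lam x i)⁻¹ := by
  have h1 : (fun x => gam * mu x) =O[l] fun x => lam x i * s x i :=
    isBigO_of_nonneg_of_le (fun x => mul_nonneg hgam.le (h.mu_nonneg x)) fun x =>
      h.le_lam_mul_s x i
  have h2 := (isBigO_const_mul_left_iff hgam.ne').1 h1
  have h3 := ((isBigO_pi.1 h.lam_isBigO_one i).mul (isBigO_pi.1 h.lam_isBigO_one i)).mul
    (isBigO_refl (fun x => s x i * (lam x i)⁻¹) l)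
  refine h2.trans (h3.congr (fun x => ?_) fun x => by ring)
  have := (h.lam_pos x i).ne'
  field_simp

/-- A family of approximately central iterates approaching `(zstar, lbar)`, together with exact
primal-dual steps whose complementarity perturbation is quadratic in the duality measure. -/
structure StepFamily (P : NLP n m) (zstar : Fin n → ℝ) (lbar : Fin m → ℝ) (C gam Kt : ℝ)
    {α : Type*} (l : Filter α) (mu : α → ℝ) (z : α → Fin n → ℝ) (lam s t : α → Fin m → ℝ)
    (dz : α → Fin n → ℝ) (dl ds : α → Fin m → ℝ) : Prop
    extends IterateFamily P zstar lbar C gam l mu z lam s where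
  perturbation_le : ∀ x, evnorm (t x) ≤ Kt * dmu (lam x) (s x) ^ 2
  exactStep : ∀ x, P.exactStep (z x) (lam x) (s x) (t x) (dz x) (dl x) (ds x)

namespace StepFamily

theorem dual_eq (h : StepFamily P zstar lbar C gam Kt l mu z lam s t dz dl ds) (x : α) :
    (P.Lzz (z x) (lam x)).mulVec (dz x) + ∑ i, dl x i • P.gradg i (z x) =
      -P.Lz (z x) (lam x) := by
  ext j
  have := (h.exactStep x).1 j
  simp only [Pi.add_apply, Finset.sum_apply, Pi.smul_apply, smul_eq_mul, Pi.neg_apply]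
  rw [← this]
  congr 1
  exact Finset.sum_congr rfl fun i _ => mul_comm _ _

theorem primal_eq (h : StepFamily P zstar lbar C gam Kt l mu z lam s t dz dl ds) (x : α)
    (i : Fin m) : P.gradg i (z x) ⬝ᵥ dz x + ds x i = -(P.g i (z x) + s x i) :=
  (h.exactStep x).2.1 i

theorem compl_eq (h : StepFamily P zstar lbar C gam Kt l mu z lam s t dz dl ds) (x : α)
    (i : Fin m) : s x i * dl x i + lam x i * ds x i = -(s x i * lam x i + t x i) :=
  (h.exactStep x).2.2 i

theorem t_isBigO (h : StepFamily P zstar lbar C gam Kt l mu z lam s t dz dl ds) (i : Fin m) :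
    (fun x => t x i) =O[l] fun x => mu x ^ 2 :=
  IsBigO.of_bound Kt (Eventually.of_forall fun x => by
    rw [Real.norm_of_nonneg (sq_nonneg _), h.mu_eq]
    exact (abs_le_evnorm _ _).trans (h.perturbation_le x))

theorem t_isBigO_mu (h : StepFamily P zstar lbar C gam Kt l mu z lam s t dz dl ds) (i : Fin m) :
    (fun x => t x i) =O[l] mu := by
  refine (h.t_isBigO i).trans ?_
  simpa [sq] using h.mu_isBigO_one.mul (isBigO_refl mu l)

theorem mu_isBigO_add (h : StepFamily P zstar lbar C gam Kt l mu z lam s t dz dl ds) :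
    mu =O[l] fun x => mu x + ‖dz x‖ :=
  isBigO_of_nonneg_of_le h.mu_nonneg fun x => by linarith [norm_nonneg (dz x)]

theorem norm_dz_isBigO_add (h : StepFamily P zstar lbar C gam Kt l mu z lam s t dz dl ds) :
    (fun x => ‖dz x‖) =O[l] fun x => mu x + ‖dz x‖ :=
  isBigO_of_nonneg_of_le (fun x => norm_nonneg _) fun x => by linarith [h.mu_nonneg x]

theorem mu_isBigO_add_mul (h : StepFamily P zstar lbar C gam Kt l mu z lam s t dz dl ds) :
    mu =O[l] fun x => mu x + mu x * ‖dz x‖ :=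
  isBigO_of_nonneg_of_le h.mu_nonneg fun x => by
    linarith [mul_nonneg (h.mu_nonneg x) (norm_nonneg (dz x))]

theorem mu_mul_isBigO (h : StepFamily P zstar lbar C gam Kt l mu z lam s t dz dl ds) :
    (fun x => mu x * (mu x + ‖dz x‖)) =O[l] fun x => mu x + mu x * ‖dz x‖ := by
  have h1 : (fun x => mu x * ‖dz x‖) =O[l] fun x => mu x + mu x * ‖dz x‖ :=
    isBigO_of_nonneg_of_le (fun x => mul_nonneg (h.mu_nonneg x) (norm_nonneg _)) fun x => by
      linarith [h.mu_nonneg x]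
  have h2 : (fun x => mu x * mu x) =O[l] mu := by
    simpa using h.mu_isBigO_one.mul (isBigO_refl mu l)
  exact ((h2.trans h.mu_isBigO_add_mul).add h1).congr_left fun x => by ring

theorem add_mul_isBigO_add (h : StepFamily P zstar lbar C gam Kt l mu z lam s t dz dl ds) :
    (fun x => mu x + mu x * ‖dz x‖) =O[l] fun x => mu x + ‖dz x‖ := by
  have h2 : (fun x => mu x * ‖dz x‖) =O[l] fun x => ‖dz x‖ := by
    simpa using h.mu_isBigO_one.mul (isBigO_refl (fun x => ‖dz x‖) l)
  exact h.mu_isBigO_add.add (h2.trans h.norm_dz_isBigO_add)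

theorem gradg_dotProduct_dz_isBigO (h : StepFamily P zstar lbar C gam Kt l mu z lam s t dz dl ds)
    (i : Fin m) : (fun x => P.gradg i (z x) ⬝ᵥ dz x) =O[l] fun x => ‖dz x‖ := by
  simpa using (h.gradg_isBigO_one i).dotProduct (isBigO_refl dz l).norm_right

theorem ds_isBigO_add (h : StepFamily P zstar lbar C gam Kt l mu z lam s t dz dl ds) (i : Fin m) :
    (fun x => ds x i) =O[l] fun x => mu x + ‖dz x‖ :=
  (((h.residual_isBigO i).trans h.mu_isBigO_add).neg_left.sub
    ((h.gradg_dotProduct_dz_isBigO i).trans h.norm_dz_isBigO_add)).congr_left fun x => by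
      linarith [h.primal_eq x i]

theorem dl_inactive_isBigO (h : StepFamily P zstar lbar C gam Kt l mu z lam s t dz dl ds)
    (hsol : P.isSolution zstar) {i : Fin m} (hi : i ∉ P.active zstar) :
    (fun x => dl x i) =O[l] fun x => mu x + mu x * ‖dz x‖ := by
  have h1 := ((h.lam_mul_s_isBigO i).add (h.t_isBigO_mu i)).trans h.mu_isBigO_add_mul
  have h2 := ((h.lam_inactive_isBigO hsol hi).mul (h.ds_isBigO_add i)).trans h.mu_mul_isBigO
  refine ((h.inv_s_isBigO_one hsol hi).mul (h1.add h2).neg_left).congr (fun x => ?_)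
    fun x => one_mul _
  have := (h.s_pos x i).ne'
  rw [inv_mul_eq_iff_eq_mul₀ this]
  linarith [h.compl_eq x i]

theorem gradg_dotProduct_dz_eq (h : StepFamily P zstar lbar C gam Kt l mu z lam s t dz dl ds)
    (x : α) (i : Fin m) : P.gradg i (z x) ⬝ᵥ dz x =
      -P.g i (z x) + t x i * (lam x i)⁻¹ + s x i * (lam x i)⁻¹ * dl x i := by
  have h1 := (h.lam_pos x i).ne'
  have h2 := h.primal_eq x i
  have h3 := h.compl_eq x i
  field_simp
  linear_combination lam x i * h2 - h3

theorem t_div_lam_isBigO (h : StepFamily P zstar lbar C gam Kt l mu z lam s t dz dl ds)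
    (hgam : 0 < gam) (hsol : P.isSolution zstar) (hsoc : P.SOC zstar) (hsc : P.StrictComp zstar)
    (hl : lbar ∈ P.Slam zstar) {i : Fin m} (hi : i ∈ P.active zstar) :
    (fun x => t x i * (lam x i)⁻¹) =O[l] fun x => mu x ^ 2 := by
  simpa using (h.t_isBigO i).mul (h.inv_lam_isBigO_one hgam hsol hsoc hsc hl hi)

theorem gradg_sub_dotProduct_dz_isBigO
    (h : StepFamily P zstar lbar C gam Kt l mu z lam s t dz dl ds)
    (hsol : P.isSolution zstar) (hsoc : P.SOC zstar) (hsc : P.StrictComp zstar)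
    (hl : lbar ∈ P.Slam zstar) (i : Fin m) :
    (fun x => (P.gradg i (z x) - P.gradg i zstar) ⬝ᵥ dz x) =O[l] fun x => mu x * ‖dz x‖ :=
  ((h.gradg_sub_isBigO i).trans (h.dist_isBigO hsol hsoc hsc hl)).dotProduct
    (isBigO_refl dz l).norm_right

theorem Lzz_mulVec_dz_isBigO (h : StepFamily P zstar lbar C gam Kt l mu z lam s t dz dl ds) :
    (fun x => (P.Lzz (z x) (lam x)).mulVec (dz x)) =O[l] fun x => ‖dz x‖ := by
  simpa using ((P.tendsto_matCLM_Lzz h.tendsto_z h.tendsto_lam).isBigO_one ℝ).mulVec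
    (isBigO_refl dz l).norm_right

/-- The multiplier step is controlled by the duality measure and the primal step. -/
theorem dl_isBigO_add (h : StepFamily P zstar lbar C gam Kt l mu z lam s t dz dl ds)
    (hgam : 0 < gam) (hsol : P.isSolution zstar) (hsoc : P.SOC zstar) (hsc : P.StrictComp zstar)
    (hl : lbar ∈ P.Slam zstar) : dl =O[l] fun x => mu x + ‖dz x‖ := by
  have hmu0 := h.mu_nonneg
  set E : α → ℝ := fun x => mu x + ‖dz x‖ + mu x * ‖dl x‖ with hE
  have hE0 : ∀ x, 0 ≤ E x := fun x => by
    have := mul_nonneg (hmu0 x) (norm_nonneg (dl x))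
    have := hmu0 x
    positivity
  have hFE : (fun x => mu x + ‖dz x‖) =O[l] E :=
    isBigO_of_nonneg_of_le (fun x => add_nonneg (hmu0 x) (norm_nonneg _)) fun x => by
      have := mul_nonneg (hmu0 x) (norm_nonneg (dl x))
      simp only [hE]
      linarith
  have hLE : (fun x => mu x * ‖dl x‖) =O[l] E :=
    isBigO_of_nonneg_of_le (fun x => mul_nonneg (hmu0 x) (norm_nonneg _)) fun x => by
      have := hmu0 x
      have := norm_nonneg (dz x)
      simp only [hE]
      linarith
  have hd := h.dist_isBigO hsol hsoc hsc hl
  have hdlL : ∀ i, (fun x => dl x i) =O[l] fun x => ‖dl x‖ := fun i =>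
    isBigO_pi.1 (isBigO_refl dl l).norm_right i
  obtain ⟨Cp, -, p, hp⟩ := (P.activeMap zstar).exists_bounded_preimage
  have hinact : ∀ i ∉ P.active zstar, (fun x => dl x i) =O[l] E := fun i hi =>
    ((h.dl_inactive_isBigO hsol hi).trans h.add_mul_isBigO_add).trans hFE
  have hA : (fun x => P.activeMap zstar (dl x)) =O[l] E := by
    have h1 := (((h.Lz_isBigO.trans h.mu_isBigO_add).neg_left.sub
      (h.Lzz_mulVec_dz_isBigO.trans h.norm_dz_isBigO_add)).trans hFE).sub
      (IsBigO.fun_sum (s := (P.active zstar)ᶜ) fun i hi =>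
        ((hinact i (Finset.mem_compl.1 hi)).smul (h.gradg_isBigO_one i)).congr_right
          fun x => by simp)
    have h2 := h1.sub (IsBigO.fun_sum (s := P.active zstar) fun i _ =>
      (((hdlL i).smul ((h.gradg_sub_isBigO i).trans hd)).congr_right
        fun x => by rw [smul_eq_mul, mul_comm]).trans hLE)
    refine h2.congr_left fun x => ?_
    have h3 := h.dual_eq x
    rw [← Finset.sum_add_sum_compl (P.active zstar)] at h3
    simp only [activeMap_apply, smul_sub, Finset.sum_sub_distrib]
    rw [← h3]
    abel
  have hpE : (fun x => p (dl x)) =O[l] E :=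
    (IsBigO.of_bound Cp (Eventually.of_forall fun x => (hp _).2)).trans hA
  let q : α → Fin m → ℝ := fun x i => if i ∈ P.active zstar then dl x i - p (dl x) i else 0
  have hq : ∀ x, ∀ i ∈ P.active zstar, q x i = dl x i - p (dl x) i := fun x i hi => if_pos hi
  have hq0 : ∀ x, ∀ i ∉ P.active zstar, q x i = 0 := fun x i hi => if_neg hi
  clear_value q
  have hqq : ∀ i, (fun x => q x i) =O[l] fun x => ‖q x‖ := fun i =>
    isBigO_pi.1 (isBigO_refl q l).norm_right i
  have hqA : ∀ x (w : Fin n → ℝ), ∑ i ∈ P.active zstar, q x i * (P.gradg i zstar ⬝ᵥ w) = 0 := by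
    intro x w
    have h1 : P.activeMap zstar (dl x - p (dl x)) = 0 := by rw [map_sub, (hp _).1, sub_self]
    rw [activeMap_apply] at h1
    have h2 := congrArg (· ⬝ᵥ w) h1
    simp only [sum_dotProduct, smul_dotProduct, smul_eq_mul, zero_dotProduct] at h2
    rw [← h2]
    exact Finset.sum_congr rfl fun i hi => by rw [hq x i hi, Pi.sub_apply]
  have hsum : (fun x => ∑ i ∈ P.active zstar, s x i * (lam x i)⁻¹ * q x i ^ 2) =O[l]
      fun x => mu x * (‖q x‖ * E x) := by
    have hv : ∀ i ∈ P.active zstar, (fun x => (P.gradg i (z x) - P.gradg i zstar) ⬝ᵥ dz x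
        + (P.g i (z x) - P.g i zstar - P.gradg i zstar ⬝ᵥ (z x - zstar))
        - t x i * (lam x i)⁻¹ - s x i * (lam x i)⁻¹ * p (dl x) i) =O[l]
        fun x => mu x * E x := by
      intro i hi
      have hmu := isBigO_refl mu l
      have hsqE : (fun x => mu x ^ 2) =O[l] fun x => mu x * E x := by
        simpa only [sq] using hmu.mul (h.mu_isBigO_add.trans hFE)
      have hd2 : (fun x => ‖z x - zstar‖ ^ 2) =O[l] fun x => mu x ^ 2 := hd.pow 2
      exact ((((h.gradg_sub_dotProduct_dz_isBigO hsol hsoc hsc hl i).trans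
        (hmu.mul (h.norm_dz_isBigO_add.trans hFE))).add
        (((P.g_taylor i tendsto_const_nhds h.tendsto_z).trans hd2).trans hsqE)).sub
        ((h.t_div_lam_isBigO hgam hsol hsoc hsc hl hi).trans hsqE)).sub
        ((h.ratio_isBigO hgam hsol hsoc hsc hl hi).mul (isBigO_pi.1 hpE i))
    have := IsBigO.fun_sum (s := P.active zstar) fun i hi => (hqq i).mul (hv i hi)
    refine this.congr (fun x => ?_) fun x => by ring
    rw [← sub_zero (∑ i ∈ P.active zstar, s x i * (lam x i)⁻¹ * q x i ^ 2),
      ← hqA x (dz x + (z x - zstar)), ← Finset.sum_sub_distrib]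
    refine Finset.sum_congr rfl fun i hi => ?_
    have h1 := h.gradg_dotProduct_dz_eq x i
    have h2 := hq x i hi
    rw [sub_dotProduct, dotProduct_add, mem_active.1 hi]
    linear_combination q x i * h1 + s x i * (lam x i)⁻¹ * q x i * -h2
  have hqi : ∀ i, (fun x => q x i * q x i) =O[l] fun x => ‖q x‖ * E x := by
    intro i
    by_cases hi : i ∈ P.active zstar
    · have h1 : (fun x => s x i * (lam x i)⁻¹ * q x i ^ 2) =O[l]
          fun x => ∑ i ∈ P.active zstar, s x i * (lam x i)⁻¹ * q x i ^ 2 := by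
        have hn : ∀ x j, 0 ≤ s x j * (lam x j)⁻¹ * q x j ^ 2 := fun x j => by
          have := h.s_pos x j
          have := h.lam_pos x j
          positivity
        exact isBigO_of_nonneg_of_le (fun x => hn x i) fun x =>
          Finset.single_le_sum (fun j _ => hn x j) hi
      have h2 := ((h.isBigO_ratio hgam i).mul (isBigO_refl (fun x => q x i ^ 2) l)).trans
        (h1.trans hsum)
      refine ((isBigO_refl (fun x => (mu x)⁻¹) l).mul h2).congr (fun x => ?_) fun x => ?_
      · rw [inv_mul_cancel_left₀ (h.mu_pos i x).ne', sq]
      · rw [inv_mul_cancel_left₀ (h.mu_pos i x).ne']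
    · simpa only [hq0 _ i hi, mul_zero] using isBigO_zero _ l
  have hqE : (fun x => ‖q x‖) =O[l] E := by
    refine isBigO_of_sq_isBigO (fun x => norm_nonneg _) hE0 ?_
    refine ((isBigO_of_nonneg_of_le (fun x => sq_nonneg _) fun x =>
      norm_sq_le_dotProduct_self (q x)).trans (IsBigO.fun_sum fun i _ => hqi i)).trans ?_
    refine isBigO_of_nonneg_of_le (fun x => mul_nonneg (norm_nonneg _) (hE0 x)) fun x => ?_
    nlinarith [hE0 x, norm_nonneg (q x)]
  have hdl : dl =O[l] E := isBigO_pi.2 fun i => by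
    by_cases hi : i ∈ P.active zstar
    · refine (((hqq i).trans hqE).add (isBigO_pi.1 hpE i)).congr_left fun x => ?_
      rw [hq x i hi, sub_add_cancel]
    · exact hinact i hi
  refine (isBigO_absorb hdl.norm_left ?_).of_norm_left
  simpa using h.mu_isLittleO.mul_isBigO (isBigO_refl (fun x => ‖dl x‖) l)

theorem gradg_active_dotProduct_dz_isBigO
    (h : StepFamily P zstar lbar C gam Kt l mu z lam s t dz dl ds)
    (hgam : 0 < gam) (hsol : P.isSolution zstar) (hsoc : P.SOC zstar) (hsc : P.StrictComp zstar)
    (hl : lbar ∈ P.Slam zstar) {i : Fin m} (hi : i ∈ P.active zstar) :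
    (fun x => P.gradg i (z x) ⬝ᵥ dz x) =O[l] fun x => mu x + mu x * ‖dz x‖ := by
  simp only [h.gradg_dotProduct_dz_eq]
  have hsq : (fun x => mu x ^ 2) =O[l] mu := by
    simpa [sq] using h.mu_isBigO_one.mul (isBigO_refl mu l)
  exact (((h.g_active_isBigO hsol hsoc hsc hl hi).neg_left.add
    ((h.t_div_lam_isBigO hgam hsol hsoc hsc hl hi).trans hsq)).trans h.mu_isBigO_add_mul).add
    (((h.ratio_isBigO hgam hsol hsoc hsc hl hi).mul
      (isBigO_pi.1 (h.dl_isBigO_add hgam hsol hsoc hsc hl) i)).trans h.mu_mul_isBigO)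

theorem dz_isBigO (h : StepFamily P zstar lbar C gam Kt l mu z lam s t dz dl ds)
    (hgam : 0 < gam) (hsol : P.isSolution zstar) (hsoc : P.SOC zstar) (hsc : P.StrictComp zstar)
    (hl : lbar ∈ P.Slam zstar) : dz =O[l] mu := by
  have hu : dz =O[l] fun x => ‖dz x‖ := (isBigO_refl dz l).norm_right
  have hdl := h.dl_isBigO_add hgam hsol hsoc hsc hl
  have hquad : (fun x => dz x ⬝ᵥ (P.Lzz (z x) (lam x)).mulVec (dz x)) =O[l]
      fun x => (mu x + mu x * ‖dz x‖) * (mu x + ‖dz x‖) := by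
    have h1 := ((h.Lz_isBigO.trans h.mu_isBigO_add_mul).dotProduct
      (hu.trans h.norm_dz_isBigO_add)).neg_left
    have h2 := IsBigO.fun_sum (s := (P.active zstar)ᶜ) fun i hi =>
      (h.dl_inactive_isBigO hsol (Finset.mem_compl.1 hi)).mul
        ((h.gradg_dotProduct_dz_isBigO i).trans h.norm_dz_isBigO_add)
    have h3 := IsBigO.fun_sum (s := P.active zstar) fun i hi =>
      ((isBigO_pi.1 hdl i).mul
        (h.gradg_active_dotProduct_dz_isBigO hgam hsol hsoc hsc hl hi)).congr_right
          fun x => mul_comm _ _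
    refine (h1.sub (h3.add h2)).congr_left fun x => ?_
    have h4 := congrArg (· ⬝ᵥ dz x) (h.dual_eq x)
    simp only [add_dotProduct, sum_dotProduct, smul_dotProduct, smul_eq_mul, neg_dotProduct] at h4
    rw [Finset.sum_add_sum_compl, ← h4, dotProduct_comm (dz x)]
    ring
  have hsq := sq_norm_isBigO_of_quadratic hsoc hsc hl h.tendsto_z h.tendsto_lam hquad
    fun i hi => by
      have hmu : (fun x => mu x * ‖dz x‖) =O[l] fun x => mu x + mu x * ‖dz x‖ :=
        isBigO_of_nonneg_of_le (fun x => mul_nonneg (h.mu_nonneg x) (norm_nonneg _)) fun x => by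
          linarith [h.mu_nonneg x]
      have h1 := (h.gradg_active_dotProduct_dz_isBigO hgam hsol hsoc hsc hl hi).sub
        ((h.gradg_sub_dotProduct_dz_isBigO hsol hsoc hsc hl i).trans hmu)
      simp only [sub_dotProduct, sub_sub_cancel] at h1
      simpa only [sq] using h1.mul (h1.trans h.add_mul_isBigO_add)
  have hsmall : (fun x => mu x * ‖dz x‖ ^ 2) =o[l] fun x => ‖dz x‖ ^ 2 := by
    simpa using h.mu_isLittleO.mul_isBigO (isBigO_refl (fun x => ‖dz x‖ ^ 2) l)
  have h1 : (fun x => ‖dz x‖ ^ 2) =O[l] fun x => mu x * (mu x + mu x * ‖dz x‖ + ‖dz x‖) :=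
    isBigO_absorb (hsq.congr_right fun x => by ring) hsmall
  refine (isBigO_of_sq_isBigO (fun x => norm_nonneg _) h.mu_nonneg (h1.trans ?_)).of_norm_left
  exact (isBigO_refl mu l).mul (h.add_mul_isBigO_add.add h.norm_dz_isBigO_add)

theorem dl_isBigO (h : StepFamily P zstar lbar C gam Kt l mu z lam s t dz dl ds)
    (hgam : 0 < gam) (hsol : P.isSolution zstar) (hsoc : P.SOC zstar) (hsc : P.StrictComp zstar)
    (hl : lbar ∈ P.Slam zstar) : dl =O[l] mu :=
  (h.dl_isBigO_add hgam hsol hsoc hsc hl).trans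
    ((isBigO_refl mu l).add (h.dz_isBigO hgam hsol hsoc hsc hl).norm_left)

theorem ds_isBigO (h : StepFamily P zstar lbar C gam Kt l mu z lam s t dz dl ds)
    (hgam : 0 < gam) (hsol : P.isSolution zstar) (hsoc : P.SOC zstar) (hsc : P.StrictComp zstar)
    (hl : lbar ∈ P.Slam zstar) (i : Fin m) : (fun x => ds x i) =O[l] mu :=
  (h.ds_isBigO_add i).trans
    ((isBigO_refl mu l).add (h.dz_isBigO hgam hsol hsoc hsc hl).norm_left)

end StepFamily

end Step

end NLP

namespace NLP

section Progress

variable {n m : ℕ} {P : NLP n m} {zstar : Fin n → ℝ} {lbar : Fin m → ℝ} {C gam Kt : ℝ}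
  {α : Type*} {l : Filter α} {mu : α → ℝ} {z : α → Fin n → ℝ} {lam s t : α → Fin m → ℝ}
  {dz : α → Fin n → ℝ} {dl ds : α → Fin m → ℝ} {a : α → ℝ}

theorem tendsto_step (hz : Tendsto z l (𝓝 zstar)) (hmu : Tendsto mu l (𝓝 0))
    (hstep : (fun x => a x • dz x) =O[l] mu) :
    Tendsto (fun x => z x + a x • dz x) l (𝓝 zstar) := by
  simpa using hz.add (hstep.trans_tendsto hmu)

/-- The decrease estimates and positivity along the step `(dz, dl, ds)` with step length `a`. -/
structure ProgressBound (P : NLP n m) (K : ℝ) (z : Fin n → ℝ) (lam s : Fin m → ℝ)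
    (dz : Fin n → ℝ) (dl ds : Fin m → ℝ) (a : ℝ) : Prop where
  pos : a < 1 - K * dmu lam s → ∀ i, 0 < lam i + a * dl i ∧ 0 < s i + a * ds i
  prod : ∀ i, |(lam i + a * dl i) * (s i + a * ds i) - (1 - a) * (lam i * s i)| ≤
    K * dmu lam s ^ 2
  duality : |dmu (lam + a • dl) (s + a • ds) - (1 - a) * dmu lam s| ≤ K * dmu lam s ^ 2
  dual : evnorm (P.Lz (z + a • dz) (lam + a • dl) - (1 - a) • P.Lz z lam) ≤ K * dmu lam s ^ 2
  primal : evnorm (fun i => P.g i (z + a • dz) + s i + a * ds i - (1 - a) * (P.g i z + s i)) ≤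
    K * dmu lam s ^ 2

theorem ProgressBound.mono {K K' : ℝ} {z : Fin n → ℝ} {lam s : Fin m → ℝ} {dz : Fin n → ℝ}
    {dl ds : Fin m → ℝ} {a : ℝ} (h : P.ProgressBound K z lam s dz dl ds a) (hK : K ≤ K')
    (hmu : 0 ≤ dmu lam s) : P.ProgressBound K' z lam s dz dl ds a := by
  have h1 : K * dmu lam s ≤ K' * dmu lam s := mul_le_mul_of_nonneg_right hK hmu
  have h2 : K * dmu lam s ^ 2 ≤ K' * dmu lam s ^ 2 :=
    mul_le_mul_of_nonneg_right hK (sq_nonneg _)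
  exact ⟨fun h' => h.pos (by linarith), fun i => (h.prod i).trans h2, h.duality.trans h2,
    h.dual.trans h2, h.primal.trans h2⟩

theorem eventually_pos_add_mul {y dy : α → ℝ} (hy : ∀ x, 0 < y x)
    (hinv : (fun x => (y x)⁻¹) =O[l] fun _ => (1 : ℝ)) (hdy : dy =O[l] mu)
    (hmu : Tendsto mu l (𝓝 0)) (ha0 : ∀ x, 0 ≤ a x) (ha1 : ∀ x, a x ≤ 1) :
    ∀ᶠ x in l, 0 < y x + a x * dy x := by
  have h1 : (fun x => (y x)⁻¹ * dy x) =O[l] mu := by simpa using hinv.mul hdy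
  filter_upwards [(h1.trans_tendsto hmu).eventually_const_lt (by norm_num : (-1 : ℝ) < 0)]
    with x hx
  have h2 : -y x < dy x := by
    have := mul_lt_mul_of_pos_left hx (hy x)
    rwa [mul_inv_cancel_left₀ (hy x).ne', mul_neg_one] at this
  rcases le_total 0 (dy x) with h | h
  · exact add_pos_of_pos_of_nonneg (hy x) (mul_nonneg (ha0 x) h)
  · nlinarith [ha1 x]

namespace StepFamily

theorem product_isBigO (h : StepFamily P zstar lbar C gam Kt l mu z lam s t dz dl ds)
    (hgam : 0 < gam) (hsol : P.isSolution zstar) (hsoc : P.SOC zstar) (hsc : P.StrictComp zstar)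
    (hl : lbar ∈ P.Slam zstar) (ha : a =O[l] fun _ => (1 : ℝ)) :
    (fun x i => (lam x i + a x * dl x i) * (s x i + a x * ds x i) -
      (1 - a x) * (lam x i * s x i)) =O[l] fun x => mu x ^ 2 := by
  refine isBigO_pi.2 fun i => ?_
  have hdl := isBigO_pi.1 (h.dl_isBigO hgam hsol hsoc hsc hl) i
  have hds := h.ds_isBigO hgam hsol hsoc hsc hl i
  have h1 := ((ha.mul ha).mul (hdl.mul hds)).sub
    ((ha.mul (h.t_isBigO i)).congr_right fun x => by ring)
  refine h1.congr (fun x => ?_) fun x => by ring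
  linear_combination -a x * h.compl_eq x i

theorem dual_residual_isBigO (h : StepFamily P zstar lbar C gam Kt l mu z lam s t dz dl ds)
    (hgam : 0 < gam) (hsol : P.isSolution zstar) (hsoc : P.SOC zstar) (hsc : P.StrictComp zstar)
    (hl : lbar ∈ P.Slam zstar) (ha : a =O[l] fun _ => (1 : ℝ)) :
    (fun x => P.Lz (z x + a x • dz x) (lam x + a x • dl x) - (1 - a x) • P.Lz (z x) (lam x))
      =O[l] fun x => mu x ^ 2 := by
  have hdl := h.dl_isBigO hgam hsol hsoc hsc hl
  have hstep : (fun x => a x • dz x) =O[l] mu := by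
    simpa using ha.smul (h.dz_isBigO hgam hsol hsoc hsc hl)
  have hy := tendsto_step h.tendsto_z h.tendsto_mu hstep
  have h1 := P.Lz_taylor h.tendsto_z hy h.lam_isBigO_one
  have h2 := fun i => P.gradg_sub_isBigO i h.tendsto_z hy
  simp only [add_sub_cancel_left] at h1 h2
  have h3 := (h1.trans (hstep.norm_left.pow 2)).add (IsBigO.fun_sum (s := Finset.univ) fun i _ =>
    ((ha.mul (isBigO_pi.1 hdl i)).smul ((h2 i).trans hstep.norm_left)).congr_right
      (g₂ := fun x => mu x ^ 2) fun x => by rw [smul_eq_mul]; ring)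
  refine h3.congr_left fun x => ?_
  have h4 := congrArg (a x • ·) (h.dual_eq x)
  have h5 := P.Lz_sub_Lz (z x + a x • dz x) (lam x + a x • dl x) (lam x)
  simp only [Pi.add_apply, Pi.smul_apply, smul_eq_mul, add_sub_cancel_left] at h5
  simp only [smul_add, Finset.smul_sum, smul_smul, smul_neg] at h4
  rw [eq_add_of_sub_eq h5]
  simp only [smul_sub, Finset.sum_sub_distrib, mulVec_smul, sub_smul, one_smul]
  rw [eq_sub_of_add_eq h4]
  abel

theorem primal_residual_isBigO (h : StepFamily P zstar lbar C gam Kt l mu z lam s t dz dl ds)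
    (hgam : 0 < gam) (hsol : P.isSolution zstar) (hsoc : P.SOC zstar) (hsc : P.StrictComp zstar)
    (hl : lbar ∈ P.Slam zstar) (ha : a =O[l] fun _ => (1 : ℝ)) :
    (fun x i => P.g i (z x + a x • dz x) + s x i + a x * ds x i -
      (1 - a x) * (P.g i (z x) + s x i)) =O[l] fun x => mu x ^ 2 := by
  refine isBigO_pi.2 fun i => ?_
  have hstep : (fun x => a x • dz x) =O[l] mu := by
    simpa using ha.smul (h.dz_isBigO hgam hsol hsoc hsc hl)
  have h1 := P.g_taylor i h.tendsto_z (tendsto_step h.tendsto_z h.tendsto_mu hstep)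
  simp only [add_sub_cancel_left, dotProduct_smul, smul_eq_mul] at h1
  refine (h1.trans (hstep.norm_left.pow 2)).congr_left fun x => ?_
  linear_combination -a x * h.primal_eq x i

theorem exists_eventually_progressBound
    (h : StepFamily P zstar lbar C gam Kt l mu z lam s t dz dl ds)
    (hgam : 0 < gam) (hsol : P.isSolution zstar) (hsoc : P.SOC zstar) (hsc : P.StrictComp zstar)
    (hl : lbar ∈ P.Slam zstar) (ha0 : ∀ x, 0 ≤ a x) (ha1 : ∀ x, a x ≤ 1) :
    ∃ K : ℝ, ∀ᶠ x in l,
      P.ProgressBound K (z x) (lam x) (s x) (dz x) (dl x) (ds x) (a x) := by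
  have ha : a =O[l] fun _ => (1 : ℝ) := isBigO_of_nonneg_of_le ha0 ha1
  have hprod := h.product_isBigO hgam hsol hsoc hsc hl ha
  have hdmu : (fun x => dmu (lam x + a x • dl x) (s x + a x • ds x) -
      (1 - a x) * dmu (lam x) (s x)) =O[l] fun x => mu x ^ 2 := by
    refine ((IsBigO.fun_sum (s := Finset.univ) fun i _ =>
      isBigO_pi.1 hprod i).const_mul_left (m : ℝ)⁻¹).congr_left fun x => ?_
    simp only [dmu, Pi.add_apply, Pi.smul_apply, smul_eq_mul, Finset.sum_sub_distrib,
      ← Finset.mul_sum]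
    ring
  obtain ⟨c₁, hc₁, h1⟩ := hprod.exists_nonneg
  obtain ⟨c₂, hc₂, h2⟩ := hdmu.exists_nonneg
  obtain ⟨c₃, hc₃, h3⟩ := (h.dual_residual_isBigO hgam hsol hsoc hsc hl ha).exists_nonneg
  obtain ⟨c₄, hc₄, h4⟩ := (h.primal_residual_isBigO hgam hsol hsoc hsc hl ha).exists_nonneg
  have hpos : ∀ᶠ x in l, ∀ i, 0 < lam x i + a x * dl x i ∨ 0 < s x i + a x * ds x i := by
    refine eventually_all.2 fun i => ?_
    by_cases hi : i ∈ P.active zstar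
    · exact (eventually_pos_add_mul (fun x => h.lam_pos x i)
        (h.inv_lam_isBigO_one hgam hsol hsoc hsc hl hi)
        (isBigO_pi.1 (h.dl_isBigO hgam hsol hsoc hsc hl) i) h.tendsto_mu ha0 ha1).mono
        fun x => Or.inl
    · exact (eventually_pos_add_mul (fun x => h.s_pos x i) (h.inv_s_isBigO_one hsol hi)
        (h.ds_isBigO hgam hsol hsoc hsc hl i) h.tendsto_mu ha0 ha1).mono fun x => Or.inr
  refine ⟨c₁ / gam + c₁ + c₂ + n * c₃ + m * c₄, ?_⟩
  filter_upwards [h1.bound, h2.bound, h3.bound, h4.bound, hpos] with x h1 h2 h3 h4 h5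
  have hg1 : 0 ≤ c₁ / gam := div_nonneg hc₁ hgam.le
  have hn : (0 : ℝ) ≤ n * c₃ := by positivity
  have hm : (0 : ℝ) ≤ m * c₄ := by positivity
  have hmu := sq_nonneg (mu x)
  rw [Real.norm_of_nonneg hmu] at h1 h2 h3 h4
  have hprod : ∀ i, |(lam x i + a x * dl x i) * (s x i + a x * ds x i) -
      (1 - a x) * (lam x i * s x i)| ≤ c₁ * mu x ^ 2 := fun i =>
    (norm_le_pi_norm (fun i => (lam x i + a x * dl x i) * (s x i + a x * ds x i) -
      (1 - a x) * (lam x i * s x i)) i).trans h1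
  have hK : ∀ c, c ≤ c₁ / gam + c₁ + c₂ + n * c₃ + m * c₄ → c * mu x ^ 2 ≤
      (c₁ / gam + c₁ + c₂ + n * c₃ + m * c₄) * dmu (lam x) (s x) ^ 2 := fun c hc => by
    rw [← h.mu_eq]
    exact mul_le_mul_of_nonneg_right hc hmu
  refine ⟨fun hlt i => ?_, fun i => (hprod i).trans (hK _ (by linarith)),
    h2.trans (hK _ (by linarith)), ?_, ?_⟩
  · have hmui := h.mu_pos i x
    rw [← h.mu_eq] at hlt
    have hlt' : c₁ * mu x < gam * (1 - a x) := by
      have h6 : c₁ / gam * mu x ≤ (c₁ / gam + c₁ + c₂ + n * c₃ + m * c₄) * mu x :=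
        mul_le_mul_of_nonneg_right (by linarith) hmui.le
      have h7 : c₁ / gam * mu x < 1 - a x := by linarith
      rwa [div_mul_eq_mul_div, div_lt_iff₀ hgam, mul_comm (1 - a x)] at h7
    have h6 := (abs_le.1 (hprod i)).1
    have h7 := mul_le_mul_of_nonneg_left (h.le_lam_mul_s x i) (sub_nonneg.2 (ha1 x))
    have h8 := mul_lt_mul_of_pos_right hlt' hmui
    have h9 : 0 < (lam x i + a x * dl x i) * (s x i + a x * ds x i) := by nlinarith
    rcases h5 i with h10 | h10
    · exact ⟨h10, (pos_iff_pos_of_mul_pos h9).1 h10⟩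
    · exact ⟨(pos_iff_pos_of_mul_pos h9).2 h10, h10⟩
  · refine (evnorm_le_card_mul_norm _).trans (le_trans ?_ (hK (n * c₃) (by linarith)))
    rw [Fintype.card_fin, mul_assoc]
    exact mul_le_mul_of_nonneg_left h3 (Nat.cast_nonneg n)
  · refine (evnorm_le_card_mul_norm _).trans (le_trans ?_ (hK (m * c₄) (by linarith)))
    rw [Fintype.card_fin, mul_assoc]
    exact mul_le_mul_of_nonneg_left h4 (Nat.cast_nonneg m)

end StepFamily

/-- Every exact step from an approximately central iterate in `W` with duality measure at most
`mubar` satisfies the progress bounds with constant `K`. -/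
def HasProgress (P : NLP n m) (C gam Kt K mubar : ℝ)
    (W : Set ((Fin n → ℝ) × (Fin m → ℝ))) : Prop :=
  ∀ z lam s t dz dl ds, (z, lam) ∈ W → P.central C gam z lam s → dmu lam s ≤ mubar →
    evnorm t ≤ Kt * dmu lam s ^ 2 → P.exactStep z lam s t dz dl ds →
    ∀ a : ℝ, 0 ≤ a → a ≤ 1 → P.ProgressBound K z lam s dz dl ds a

theorem dmu_nonneg_of_central {z : Fin n → ℝ} {lam s : Fin m → ℝ}
    (h : P.central C gam z lam s) : 0 ≤ dmu lam s :=
  div_nonneg (Finset.sum_nonneg fun i _ => (mul_pos (h.2.2.1 i) (h.2.2.2.1 i)).le)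
    (Nat.cast_nonneg m)

theorem HasProgress.union {K K' mubar mubar' : ℝ} {W W' : Set ((Fin n → ℝ) × (Fin m → ℝ))}
    (h : P.HasProgress C gam Kt K mubar W) (h' : P.HasProgress C gam Kt K' mubar' W') :
    P.HasProgress C gam Kt (max K K') (min mubar mubar') (W ∪ W') := by
  intro z lam s t dz dl ds hW hc hmu ht hstep a ha0 ha1
  have hmu0 := dmu_nonneg_of_central hc
  rcases hW with hW | hW
  · exact (h z lam s t dz dl ds hW hc (hmu.trans (min_le_left _ _)) ht hstep a ha0 ha1).mono
      (le_max_left _ _) hmu0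
  · exact (h' z lam s t dz dl ds hW hc (hmu.trans (min_le_right _ _)) ht hstep a ha0 ha1).mono
      (le_max_right _ _) hmu0

theorem exists_hasProgress_near (hsol : P.isSolution zstar) (hsoc : P.SOC zstar)
    (hsc : P.StrictComp zstar) (hgam : 0 < gam) (C Kt : ℝ) (hl : lbar ∈ P.Slam zstar) :
    ∃ K > 0, ∃ mubar > 0, ∃ W, IsOpen W ∧ (zstar, lbar) ∈ W ∧
      P.HasProgress C gam Kt K mubar W := by
  let α := {T : ((Fin n → ℝ) × (Fin m → ℝ)) × (Fin m → ℝ) × (Fin m → ℝ) × (Fin n → ℝ) ×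
      (Fin m → ℝ) × (Fin m → ℝ) × ℝ //
    P.central C gam T.1.1 T.1.2 T.2.1 ∧ evnorm T.2.2.1 ≤ Kt * dmu T.1.2 T.2.1 ^ 2 ∧
    P.exactStep T.1.1 T.1.2 T.2.1 T.2.2.1 T.2.2.2.1 T.2.2.2.2.1 T.2.2.2.2.2.1 ∧
    0 ≤ T.2.2.2.2.2.2 ∧ T.2.2.2.2.2.2 ≤ 1}
  let f : α → ((Fin n → ℝ) × (Fin m → ℝ)) × ℝ := fun T => (T.1.1, dmu T.1.1.2 T.1.2.1)
  have hf : Tendsto f (comap f (𝓝 ((zstar, lbar), 0))) (𝓝 ((zstar, lbar), 0)) := tendsto_comap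
  have hstep : StepFamily P zstar lbar C gam Kt (comap f (𝓝 ((zstar, lbar), 0)))
      (fun T => dmu T.1.1.2 T.1.2.1) (fun T => T.1.1.1) (fun T => T.1.1.2) (fun T => T.1.2.1)
      (fun T => T.1.2.2.1) (fun T => T.1.2.2.2.1) (fun T => T.1.2.2.2.2.1)
      (fun T => T.1.2.2.2.2.2.1) :=
    { mu_eq := fun _ => rfl
      tendsto_z := hf.fst_nhds.fst_nhds
      tendsto_lam := hf.fst_nhds.snd_nhds
      tendsto_mu := hf.snd_nhds
      central := fun T => T.2.1
      perturbation_le := fun T => T.2.2.1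
      exactStep := fun T => T.2.2.2.1 }
  obtain ⟨K, hK⟩ := hstep.exists_eventually_progressBound hgam hsol hsoc hsc hl
    (a := fun T => T.1.2.2.2.2.2.2) (fun T => T.2.2.2.2.1) (fun T => T.2.2.2.2.2)
  rw [eventually_comap, nhds_prod_eq, eventually_prod_iff] at hK
  obtain ⟨p, hp, q, hq, hpq⟩ := hK
  obtain ⟨W, hWp, hW, hmem⟩ := eventually_nhds_iff.1 hp
  obtain ⟨ε, hε, hball⟩ := Metric.eventually_nhds_iff.1 hq
  refine ⟨max K 1, by positivity, ε / 2, half_pos hε, W, hW, hmem, ?_⟩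
  intro z lam s t dz dl ds hzW hc hmu ht hex a ha0 ha1
  have hmu0 := dmu_nonneg_of_central hc
  refine ProgressBound.mono ?_ (le_max_left K 1) hmu0
  refine hpq (hWp _ hzW) (hball (y := dmu lam s) ?_)
    ⟨((z, lam), s, t, dz, dl, ds, a), hc, ht, hex, ha0, ha1⟩ rfl
  rw [dist_zero_right, Real.norm_of_nonneg hmu0]
  linarith

theorem exists_hasProgress (hsol : P.isSolution zstar) (hmfcq : P.MFCQ zstar)
    (hsoc : P.SOC zstar) (hsc : P.StrictComp zstar) (hgam : 0 < gam) (C Kt : ℝ) :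
    ∃ K > 0, ∃ mubar > 0, ∃ W, IsOpen W ∧ (∀ ls ∈ P.Slam zstar, (zstar, ls) ∈ W) ∧
      P.HasProgress C gam Kt K mubar W := by
  refine (isCompact_Slam hmfcq).induction_on (p := fun A => ∃ K > 0, ∃ mubar > 0, ∃ W,
    IsOpen W ∧ (∀ ls ∈ A, (zstar, ls) ∈ W) ∧ P.HasProgress C gam Kt K mubar W) ?_ ?_ ?_ ?_
  · exact ⟨1, one_pos, 1, one_pos, ∅, isOpen_empty, by simp,
      fun _ _ _ _ _ _ _ hW => absurd hW (Set.notMem_empty _)⟩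
  · rintro A A' hA ⟨K, hK, mubar, hmu, W, hW, hmem, hprog⟩
    exact ⟨K, hK, mubar, hmu, W, hW, fun ls hls => hmem ls (hA hls), hprog⟩
  · rintro A A' ⟨K, hK, mubar, hmu, W, hW, hmem, hprog⟩ ⟨K', -, mubar', hmu', W', hW', hmem', hprog'⟩
    exact ⟨max K K', lt_max_of_lt_left hK, min mubar mubar', lt_min hmu hmu', W ∪ W', hW.union hW',
      fun ls hls => hls.imp (hmem ls) (hmem' ls), hprog.union hprog'⟩
  · intro lbar hl
    obtain ⟨K, hK, mubar, hmu, W, hW, hmem, hprog⟩ :=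
      exists_hasProgress_near hsol hsoc hsc hgam C Kt hl
    have hcont : Continuous fun ls : Fin m → ℝ => (zstar, ls) := by fun_prop
    exact ⟨_, mem_nhdsWithin_of_mem_nhds ((hW.preimage hcont).mem_nhds hmem),
      K, hK, mubar, hmu, W, hW, fun ls hls => hls, hprog⟩

end Progress

end NLP

end ExactStep

/-- **progress along the exact step.** Suppose `z*` is a solution at
which MFCQ, the second-order condition and strict complementarity are satisfied, fix
centrality constants `C > 0`, `γ ∈ (0,1)`, and suppose `‖t‖ ≤ K_t μ²`.  Then there
exist `K > 0`, `μ̄ > 0` and a neighborhood `W` of `S` such that for every iterate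
`(z,λ,s)` satisfying the approximate centrality conditions with `(z,λ) ∈ W` and
`μ ≤ μ̄`, the exact step `(Δz,Δλ,Δs)` satisfies: (i) there exists `α_max ∈ [0,1]`
with `1 − α_max ≤ Kμ` such that `λ + αΔλ > 0` and `s + αΔs > 0` for all
`α ∈ [0, α_max)`; and (ii) for all `α ∈ [0,1]` and all `i`, the four displayed
decrease estimates hold with tolerance `Kμ²`. -/
theorem stmt11_exact_step_progress
    {n m : ℕ} (P : NLP n m) (zstar : Fin n → ℝ)
    (hsol : P.isSolution zstar)
    (hmfcq : P.MFCQ zstar)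
    (hsoc : P.SOC zstar)
    (hsc : P.StrictComp zstar)
    (C gam Kt : ℝ) (hC : 0 < C) (hgam0 : 0 < gam) (hgam1 : gam < 1) (hKt : 0 < Kt) :
    ∃ K : ℝ, 0 < K ∧
      ∃ mubar : ℝ, 0 < mubar ∧
        ∃ W : Set ((Fin n → ℝ) × (Fin m → ℝ)), IsOpen W ∧
          (∀ ls ∈ P.Slam zstar, (zstar, ls) ∈ W) ∧
          ∀ z : Fin n → ℝ, ∀ lam s t : Fin m → ℝ,
            ∀ dz : Fin n → ℝ, ∀ dl ds : Fin m → ℝ,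
            (z, lam) ∈ W → P.central C gam z lam s → dmu lam s ≤ mubar →
            evnorm t ≤ Kt * dmu lam s ^ 2 →
            P.exactStep z lam s t dz dl ds →
            (∃ amax : ℝ, 0 ≤ amax ∧ amax ≤ 1 ∧ 1 - amax ≤ K * dmu lam s ∧
              ∀ a : ℝ, 0 ≤ a → a < amax →
                ∀ i, 0 < lam i + a * dl i ∧ 0 < s i + a * ds i) ∧
            (∀ a : ℝ, 0 ≤ a → a ≤ 1 →
              (∀ i, |(lam i + a * dl i) * (s i + a * ds i) -
                  (1 - a) * (lam i * s i)| ≤ K * dmu lam s ^ 2) ∧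
              |dmu (lam + a • dl) (s + a • ds) - (1 - a) * dmu lam s| ≤
                K * dmu lam s ^ 2 ∧
              evnorm (P.Lz (z + a • dz) (lam + a • dl) - (1 - a) • P.Lz z lam) ≤
                K * dmu lam s ^ 2 ∧
              evnorm (fun i => P.g i (z + a • dz) + s i + a * ds i -
                  (1 - a) * (P.g i z + s i)) ≤ K * dmu lam s ^ 2) := by
  obtain ⟨K, hK, mubar, hmu, W, hW, hmem, hprog⟩ :=
    NLP.exists_hasProgress hsol hmfcq hsoc hsc hgam0 C Kt
  refine ⟨K, hK, mubar, hmu, W, hW, hmem, fun z lam s t dz dl ds hzW hc hmu ht hex => ?_⟩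
  have hmu0 := mul_nonneg hK.le (NLP.dmu_nonneg_of_central hc)
  have key := hprog z lam s t dz dl ds hzW hc hmu ht hex
  refine ⟨⟨max 0 (1 - K * dmu lam s), le_max_left _ _, max_le zero_le_one (by linarith), ?_, ?_⟩,
    fun a ha0 ha1 => ?_⟩
  · linarith [le_max_right 0 (1 - K * dmu lam s)]
  · intro a ha0 ha
    have ha' := (lt_max_iff.1 ha).resolve_left (not_lt.2 ha0)
    exact (key a ha0 (by linarith)).pos ha'
  · exact ⟨(key a ha0 ha1).prod, (key a ha0 ha1).duality, (key a ha0 ha1).dual,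
      (key a ha0 ha1).primal⟩
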